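/- arXiv:1810.12639 — 6 statements merged into one kernel-verified Lean document; each statement's English description precedes it below -/
import Mathlib

section
/- If there exists a t-tuple of pairwise orthogonal k × n₁ Latin rectangles and a t-tuple of pairwise orthogonal k × n₂ Latin rectangles, then there exists a t-tuple of pairwise orthogonal k × (n₁ + n₂) Latin rectangles. -/
/-- A `k × n` Latin rectangle: each row contains each symbol exactly once
(equivalently, each row is injective `Fin n → Fin n`), and the entries of
each column are pairwise distinct. -/
def IsLatinRectangle {k n : ℕ} (A : Fin k → Fin n → Fin n) : Prop :=
  (∀ i, Function.Injective (A i)) ∧ (∀ j, Function.Injective fun i => A i j)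

/-- Two `k × n` rectangles are orthogonal if the pairs `(A i j, B i j)` over all
cells are pairwise distinct. -/
def Orthogonal {k n : ℕ} (A B : Fin k → Fin n → Fin n) : Prop :=
  Function.Injective fun p : Fin k × Fin n => (A p.1 p.2, B p.1 p.2)

/-- The set of symbols occurring in column `c`. -/
def colSymbols {k n : ℕ} (A : Fin k → Fin n → Fin n) (c : Fin n) : Finset (Fin n) :=
  Finset.univ.image fun i => A i c

/-- A Youden rectangle with parameter `lam`: every pair of distinct columns has
exactly `lam` symbols in common. -/
def IsYouden {k n : ℕ} (A : Fin k → Fin n → Fin n) (lam : ℕ) : Prop :=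
  ∀ c c' : Fin n, c ≠ c' → (colSymbols A c ∩ colSymbols A c').card = lam

/-- The concatenation of a `k × n₁` and a `k × n₂` rectangle, with the symbols of the second one
shifted by `n₁`. -/
def appendRectangle {k n₁ n₂ : ℕ} (A : Fin k → Fin n₁ → Fin n₁) (B : Fin k → Fin n₂ → Fin n₂) :
    Fin k → Fin (n₁ + n₂) → Fin (n₁ + n₂) :=
  fun i x => finSumFinEquiv (Sum.map (A i) (B i) (finSumFinEquiv.symm x))

theorem IsLatinRectangle.append {k n₁ n₂ : ℕ} {A : Fin k → Fin n₁ → Fin n₁}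
    {B : Fin k → Fin n₂ → Fin n₂} (hA : IsLatinRectangle A) (hB : IsLatinRectangle B) :
    IsLatinRectangle (appendRectangle A B) := by
  refine ⟨fun i => finSumFinEquiv.injective.comp
    (((hA.1 i).sumMap (hB.1 i)).comp finSumFinEquiv.symm.injective), fun x => ?_⟩
  refine finSumFinEquiv.injective.comp
    (f := fun i => Sum.map (A i) (B i) (finSumFinEquiv.symm x)) ?_
  rcases finSumFinEquiv.symm x with j | j
  · exact Sum.inl_injective.comp (hA.2 j)
  · exact Sum.inr_injective.comp (hB.2 j)

theorem Orthogonal.append {k n₁ n₂ : ℕ} {A A' : Fin k → Fin n₁ → Fin n₁}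
    {B B' : Fin k → Fin n₂ → Fin n₂} (hA : Orthogonal A A') (hB : Orthogonal B B') :
    Orthogonal (appendRectangle A B) (appendRectangle A' B') := by
  rintro ⟨i, x⟩ ⟨i', x'⟩ h
  obtain ⟨x, rfl⟩ := finSumFinEquiv.surjective x
  obtain ⟨x', rfl⟩ := finSumFinEquiv.surjective x'
  simp only [appendRectangle, Equiv.symm_apply_apply, Prod.mk.injEq,
    EmbeddingLike.apply_eq_iff_eq] at h ⊢
  rcases x with j | j <;> rcases x' with j' | j' <;>
    simp only [Sum.map_inl, Sum.map_inr, Sum.inl.injEq, Sum.inr.injEq, reduceCtorEq,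
      false_and] at h ⊢
  · exact Prod.mk.inj (@hA (i, j) (i', j') (Prod.ext h.1 h.2))
  · exact Prod.mk.inj (@hB (i, j) (i', j') (Prod.ext h.1 h.2))

theorem stmt_1 (t k n₁ n₂ : ℕ)
    (h₁ : ∃ A : Fin t → Fin k → Fin n₁ → Fin n₁,
      (∀ s, IsLatinRectangle (A s)) ∧ ∀ s s', s ≠ s' → Orthogonal (A s) (A s'))
    (h₂ : ∃ B : Fin t → Fin k → Fin n₂ → Fin n₂,
      (∀ s, IsLatinRectangle (B s)) ∧ ∀ s s', s ≠ s' → Orthogonal (B s) (B s')) :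
    ∃ C : Fin t → Fin k → Fin (n₁ + n₂) → Fin (n₁ + n₂),
      (∀ s, IsLatinRectangle (C s)) ∧ ∀ s s', s ≠ s' → Orthogonal (C s) (C s') := by
  obtain ⟨A, hA, hA'⟩ := h₁
  obtain ⟨B, hB, hB'⟩ := h₂
  exact ⟨fun s => appendRectangle (A s) (B s), fun s => (hA s).append (hB s),
    fun s s' h => (hA' s s' h).append (hB' s s' h)⟩
end

section
/- There exists a triple of mutually orthogonal 2 × 5 Latin rectangles that is maximal, i.e., there is no triple of mutually orthogonal 3 × 5 Latin rectangles whose first two rows (in each of the three rectangles) agree with it. -/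
/-- In an extension of a Latin rectangle, the new entries avoid the old ones in their column. -/
theorem IsLatinRectangle.last_ne {k n : ℕ} {A' : Fin (k + 1) → Fin n → Fin n}
    {A : Fin k → Fin n → Fin n} (h : IsLatinRectangle A') (hA : ∀ i, A' i.castSucc = A i)
    (i : Fin k) (j : Fin n) : A' (Fin.last k) j ≠ A i j := fun he =>
  (Fin.castSucc_lt_last i).ne' (h.2 j (by simpa only [hA] using he))

/-- In an orthogonal extension, the new pairs of entries avoid all the old ones. -/
theorem Orthogonal.last_ne {k n : ℕ} {A' B' : Fin (k + 1) → Fin n → Fin n}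
    {A B : Fin k → Fin n → Fin n} (h : Orthogonal A' B') (hA : ∀ i, A' i.castSucc = A i)
    (hB : ∀ i, B' i.castSucc = B i) (j : Fin n) (i : Fin k) (j' : Fin n) :
    ¬ (A' (Fin.last k) j = A i j' ∧ B' (Fin.last k) j = B i j') := fun ⟨ha, hb⟩ => by
  have he := @h (Fin.last k, j) (i.castSucc, j') (by simp [hA, hB, ha, hb])
  exact (Fin.castSucc_lt_last i).ne' (congrArg Prod.fst he)

/-- The triple `(a, b, c)` is compatible with `A`, `B`, `C` as new entries in column `j`. -/
abbrev IsColumnCandidate {k n : ℕ} (A B C : Fin k → Fin n → Fin n) (j a b c : Fin n) : Prop :=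
  (∀ i, a ≠ A i j) ∧ (∀ i, b ≠ B i j) ∧ (∀ i, c ≠ C i j) ∧
    (∀ i j', ¬ (a = A i j' ∧ b = B i j')) ∧ (∀ i j', ¬ (a = A i j' ∧ c = C i j')) ∧
    ∀ i j', ¬ (b = B i j' ∧ c = C i j')

theorem stmt_7 :
    ∃ A B C : Fin 2 → Fin 5 → Fin 5,
      IsLatinRectangle A ∧ IsLatinRectangle B ∧ IsLatinRectangle C ∧
      Orthogonal A B ∧ Orthogonal A C ∧ Orthogonal B C ∧
      ¬ ∃ A' B' C' : Fin 3 → Fin 5 → Fin 5,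
        IsLatinRectangle A' ∧ IsLatinRectangle B' ∧ IsLatinRectangle C' ∧
        Orthogonal A' B' ∧ Orthogonal A' C' ∧ Orthogonal B' C' ∧
        (∀ i : Fin 2, A' i.castSucc = A i) ∧
        (∀ i : Fin 2, B' i.castSucc = B i) ∧
        (∀ i : Fin 2, C' i.castSucc = C i) := by
  let A : Fin 2 → Fin 5 → Fin 5 := ![![0, 1, 2, 3, 4], ![2, 3, 1, 4, 0]]
  let B : Fin 2 → Fin 5 → Fin 5 := ![![0, 1, 2, 3, 4], ![3, 4, 0, 1, 2]]
  let C : Fin 2 → Fin 5 → Fin 5 := ![![0, 1, 2, 3, 4], ![4, 2, 3, 0, 1]]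
  refine ⟨A, B, C, ?_, ?_, ?_, ?_, ?_, ?_, ?_⟩
  iterate 3 exact ⟨by decide +kernel, by decide +kernel⟩
  iterate 3 unfold Orthogonal; decide +kernel
  rintro ⟨A', B', C', lA, lB, lC, oAB, oAC, oBC, hA, hB, hC⟩
  have cand (j : Fin 5) : IsColumnCandidate A B C j (A' 2 j) (B' 2 j) (C' 2 j) :=
    ⟨(lA.last_ne hA · j), (lB.last_ne hB · j), (lC.last_ne hC · j),
      oAB.last_ne hA hB j, oAC.last_ne hA hC j, oBC.last_ne hB hC j⟩
  -- Columns `0` and `1` both force the new entry of the first rectangle to be `4`.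
  have h₀ : ∀ a b c, IsColumnCandidate A B C 0 a b c → a = 4 := by decide +kernel
  have h₁ : ∀ a b c, IsColumnCandidate A B C 1 a b c → a = 4 := by decide +kernel
  exact absurd (lA.1 2 ((h₀ _ _ _ (cand 0)).trans (h₁ _ _ _ (cand 1)).symm)) (by decide)
end

section
/- Every triple (A, B, C) of mutually orthogonal 5 × 6 Latin rectangles cannot even be partially extended: there is no column position j and no choice of three symbols a, b, c such that appending a in column j to A, b in column j to B, and c in column j to C as (partial) sixth-row entries simultaneously preserves the Latin rectangle condition (a does not occur in column j of A, b does not occur in column j of B, c does not occur in column j of C) and the orthogonality condition (the pair (a,b) does not occur among the pairs (A_{ij}, B_{ij}), the pair (a,c) does not occur among the pairs (A_{ij}, C_{ij}), and the pair (b,c) does not occur among the pairs (B_{ij}, C_{ij}) over the existing five rows). -/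
/-! ### A kernel-friendly backtracking search

Blocks are 5-tuples `(r, c, a, b, x)`, recording that row `r` and column `c` contain the symbols
`a`, `b`, `x` of the three rectangles. A set of blocks is encoded by a bit mask which records the
pairs of coordinates it covers. The recursors are used explicitly to keep kernel reduction fast. -/

/-- Call `k` on `n`, making the kernel evaluate `n` to a literal first. -/
def force (n : ℕ) (k : ℕ → Bool) : Bool :=
  @Nat.rec (fun _ => Bool) true (fun m _ => k m) (Nat.add n 1)

/-- `true` if `u` and `m` share a bit, and `k` otherwise. -/
def unlessMeets (u m : ℕ) (k : Bool) : Bool :=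
  @Nat.rec (fun _ => Bool) k (fun _ _ => true) (Nat.land u m)

/-- Short-circuiting conjunction. -/
abbrev andThen (a b : Bool) : Bool := @Bool.rec (fun _ => Bool) false b a

/-- Conjunction of `p v` over `v < 6`. -/
def forSix (p : ℕ → Bool) : Bool :=
  andThen (p 0) (andThen (p 1) (andThen (p 2) (andThen (p 3) (andThen (p 4) (p 5)))))

/-- The bit of the pair `(x, 0)` in the `k`-th table of pairs. -/
abbrev pairBit (k x : ℕ) : ℕ := Nat.shiftLeft 1 (Nat.add (Nat.mul 36 k) (Nat.mul 6 x))

/-- Pairs between a symbol of the first rectangle and a cell, up to a shift by the symbol. -/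
abbrev baseA (r c : ℕ) : ℕ := Nat.lor (pairBit 0 r) (pairBit 1 c)

/-- Pairs between a symbol of the second rectangle and the rest, up to a shift by the symbol. -/
abbrev baseB (r c a : ℕ) : ℕ := Nat.lor (pairBit 2 r) (Nat.lor (pairBit 3 c) (pairBit 4 a))

/-- Pairs between a symbol of the third rectangle and the rest, up to a shift by the symbol. -/
abbrev baseC (r c a b : ℕ) : ℕ :=
  Nat.lor (pairBit 5 r) (Nat.lor (pairBit 6 c) (Nat.lor (pairBit 7 a) (pairBit 8 b)))

/-- The mask of all pairs of coordinates in the block `(r, c, a, b, x)`. -/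
def mask (r c a b x : ℕ) : ℕ :=
  Nat.lor (Nat.shiftLeft (baseA r c) a)
    (Nat.lor (Nat.shiftLeft (baseB r c a) b) (Nat.shiftLeft (baseC r c a b) x))

/-- Check `k` for all values `v < 6` for which `w <<< v` avoids `u`. -/
def forValues (u w : ℕ) (k : ℕ → ℕ → Bool) : Bool :=
  force w fun w => forSix fun v => unlessMeets u (Nat.shiftLeft w v) (k v (Nat.shiftLeft w v))

/-- Check `k` for all ways of filling the cell `(r, c)` compatibly with the used pairs `u`. -/
def fillCell (r c : ℕ) (k : ℕ → Bool) (u : ℕ) : Bool :=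
  force r fun r => force c fun c =>
  forValues u (baseA r c) fun a A =>
  forValues u (baseB r c a) fun b B =>
  forValues u (baseC r c a b) fun _ C =>
  force (Nat.lor u (Nat.lor A (Nat.lor B C))) k

/-- `refute l u = true` if the cells of `l` cannot be filled compatibly with the used pairs `u`. -/
def refute (l : List (ℕ × ℕ)) : ℕ → Bool :=
  @List.rec _ (fun _ => ℕ → Bool) (fun _ => false) (fun p _ k => fillCell p.1 p.2 k) l

theorem force_eq (n : ℕ) (k : ℕ → Bool) : force n k = k n := rfl

theorem unlessMeets_of_disjoint {u m : ℕ} {k : Bool} (h : unlessMeets u m k = true)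
    (hum : u &&& m = 0) : k = true := by
  have hum' : Nat.land u m = 0 := hum
  rwa [unlessMeets, hum'] at h

theorem andThen_eq_and (a b : Bool) : andThen a b = (a && b) := by cases a <;> rfl

theorem forSix_apply {p : ℕ → Bool} (h : forSix p = true) {v : ℕ} (hv : v < 6) : p v = true := by
  simp only [forSix, andThen_eq_and, Bool.and_eq_true] at h
  interval_cases v <;> tauto

theorem forValues_apply {u w : ℕ} {k : ℕ → ℕ → Bool} (h : forValues u w k = true) {v : ℕ}
    (hv : v < 6) (hu : u &&& Nat.shiftLeft w v = 0) : k v (Nat.shiftLeft w v) = true := by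
  rw [forValues, force_eq] at h
  exact unlessMeets_of_disjoint (forSix_apply h hv) hu

theorem fillCell_apply {r c a b x u : ℕ} {k : ℕ → Bool} (h : fillCell r c k u = true)
    (ha : a < 6) (hb : b < 6) (hx : x < 6) (hu : u &&& mask r c a b x = 0) :
    k (u ||| mask r c a b x) = true := by
  have hsplit : u &&& Nat.shiftLeft (baseA r c) a = 0 ∧
      u &&& Nat.shiftLeft (baseB r c a) b = 0 ∧ u &&& Nat.shiftLeft (baseC r c a b) x = 0 := by
    change u &&& (_ ||| (_ ||| _)) = 0 at hu
    simpa only [Nat.and_or_distrib_left, Nat.or_eq_zero_iff] using hu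
  rw [fillCell, force_eq, force_eq] at h
  exact forValues_apply (forValues_apply (forValues_apply h ha hsplit.1) hb hsplit.2.1) hx hsplit.2.2

/-- The mask of a block given as a vector. -/
def blockMask (t : Fin 5 → Fin 6) : ℕ := mask (t 0) (t 1) (t 2) (t 3) (t 4)

theorem not_refute (l : List (Fin 5 → Fin 6)) (u : ℕ) (hu : ∀ t ∈ l, u &&& blockMask t = 0)
    (hl : l.Pairwise fun s t => blockMask s &&& blockMask t = 0) :
    refute (l.map fun t => ((t 0 : ℕ), (t 1 : ℕ))) u ≠ true := by
  induction l generalizing u with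
  | nil => exact Bool.false_ne_true
  | cons t l ih =>
    intro h
    rw [List.pairwise_cons] at hl
    refine ih (u ||| blockMask t) (fun s hs => ?_) hl.2
      (fillCell_apply h (t 2).isLt (t 3).isLt (t 4).isLt (hu t List.mem_cons_self))
    rw [Nat.and_or_distrib_right, hu s (List.mem_cons_of_mem _ hs), hl.1 s hs, Nat.zero_or]

theorem testBit_mask {r c a b x i : ℕ} (h : (mask r c a b x).testBit i = true) :
    i = 6 * r + a ∨ i = 36 + 6 * c + a ∨ i = 72 + 6 * r + b ∨ i = 108 + 6 * c + b ∨
      i = 144 + 6 * a + b ∨ i = 180 + 6 * r + x ∨ i = 216 + 6 * c + x ∨ i = 252 + 6 * a + x ∨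
      i = 288 + 6 * b + x := by
  have h' : (((1 <<< (36 * 0 + 6 * r) ||| 1 <<< (36 * 1 + 6 * c)) <<< a) |||
      (((1 <<< (36 * 2 + 6 * r) ||| (1 <<< (36 * 3 + 6 * c) ||| 1 <<< (36 * 4 + 6 * a))) <<< b) |||
      ((1 <<< (36 * 5 + 6 * r) ||| (1 <<< (36 * 6 + 6 * c) ||| (1 <<< (36 * 7 + 6 * a) |||
        1 <<< (36 * 8 + 6 * b)))) <<< x))).testBit i = true := h
  simp only [Nat.shiftLeft_or_distrib, ← Nat.shiftLeft_add] at h'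
  simp only [Nat.testBit_or, Nat.one_shiftLeft, Nat.testBit_two_pow, Bool.or_eq_true,
    decide_eq_true_eq] at h'
  omega

/-- Two blocks are separated if they do not agree in two coordinates. -/
def Separated (s t : Fin 5 → Fin 6) : Prop := ∀ g h, g < h → s g = t g → s h ≠ t h

theorem Separated.symm {s t : Fin 5 → Fin 6} (h : Separated s t) : Separated t s :=
  fun g k hgk hg hk => h g k hgk hg.symm hk.symm

theorem Separated.blockMask_disjoint {s t : Fin 5 → Fin 6} (h : Separated s t) :
    blockMask s &&& blockMask t = 0 := by
  refine Nat.eq_of_testBit_eq fun i => ?_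
  rw [Nat.zero_testBit, Nat.testBit_and, Bool.eq_false_iff]
  intro hi
  rw [Bool.and_eq_true] at hi
  have h₁ := testBit_mask hi.1
  have h₂ := testBit_mask hi.2
  have h02 := h 0 2 (by decide)
  have h12 := h 1 2 (by decide)
  have h03 := h 0 3 (by decide)
  have h13 := h 1 3 (by decide)
  have h23 := h 2 3 (by decide)
  have h04 := h 0 4 (by decide)
  have h14 := h 1 4 (by decide)
  have h24 := h 2 4 (by decide)
  have h34 := h 3 4 (by decide)
  simp only [ne_eq, Fin.ext_iff] at h02 h12 h03 h13 h23 h04 h14 h24 h34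
  have hs := fun g => (s g).isLt
  have ht := fun g => (t g).isLt
  have hs0 := hs 0; have hs1 := hs 1; have hs2 := hs 2; have hs3 := hs 3; have hs4 := hs 4
  have ht0 := ht 0; have ht1 := ht 1; have ht2 := ht 2; have ht3 := ht 3; have ht4 := ht 4
  rcases h₁ with h₁ | h₁ | h₁ | h₁ | h₁ | h₁ | h₁ | h₁ | h₁ <;>
  rcases h₂ with h₂ | h₂ | h₂ | h₂ | h₂ | h₂ | h₂ | h₂ | h₂ <;> omega

theorem foldr_or_and_eq_zero (l : List ℕ) (n : ℕ) (h : ∀ m ∈ l, m &&& n = 0) :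
    l.foldr Nat.lor 0 &&& n = 0 := by
  induction l with
  | nil => exact Nat.zero_and n
  | cons m l ih =>
    change (m ||| l.foldr Nat.lor 0) &&& n = 0
    rw [Nat.and_or_distrib_right, h m List.mem_cons_self,
      ih fun k hk => h k (List.mem_cons_of_mem _ hk), Nat.zero_or]

/-! ### The normal forms -/

/-- The function on five points with the given values. -/
def tuple (a b c d e : Fin 5) (i : Fin 5) : Fin 5 :=
  match i.val with
  | 0 => a
  | 1 => b
  | 2 => c
  | 3 => d
  | _ => e

/-- Representatives of the pairs of disjoint derangements of five points up to conjugation, each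
with an ordering of the free cells for which the search is short. -/
def normalForms : List ((Fin 5 → Fin 5) × (Fin 5 → Fin 5) × List (Fin 5 × Fin 6)) :=
  [(tuple 1 0 3 4 2, tuple 2 3 4 0 1,
      [(1, 4), (1, 3), (1, 5), (1, 1), (0, 5), (0, 4), (0, 3), (0, 2), (3, 5), (3, 3),
        (3, 1), (3, 2), (2, 2), (4, 4), (4, 3), (2, 1), (2, 4), (4, 2), (2, 5), (4, 1)]),
    (tuple 1 0 3 4 2, tuple 2 3 4 1 0,
      [(1, 3), (1, 5), (1, 4), (1, 1), (0, 4), (0, 5), (0, 3), (0, 2), (3, 1), (3, 5),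
        (3, 3), (3, 2), (4, 2), (2, 2), (2, 5), (4, 1), (4, 4), (2, 1), (2, 4), (4, 3)]),
    (tuple 1 2 3 4 0, tuple 2 0 4 1 3,
      [(0, 4), (0, 3), (0, 2), (0, 5), (1, 5), (1, 3), (1, 4), (1, 1), (2, 4), (2, 5),
        (2, 1), (2, 2), (3, 1), (4, 1), (3, 2), (4, 3), (3, 3), (4, 4), (3, 5), (4, 2)]),
    (tuple 1 2 3 4 0, tuple 2 3 4 0 1,
      [(3, 5), (3, 1), (3, 3), (3, 2), (4, 2), (4, 1), (4, 3), (4, 4), (1, 3), (0, 3),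
        (0, 2), (0, 5), (0, 4), (1, 1), (1, 5), (2, 2), (1, 4), (2, 1), (2, 5), (2, 4)]),
    (tuple 1 2 3 4 0, tuple 2 4 0 1 3,
      [(0, 4), (0, 2), (0, 3), (0, 5), (2, 5), (2, 2), (2, 4), (2, 1), (1, 5), (1, 4),
        (1, 3), (1, 1), (4, 2), (4, 4), (4, 1), (3, 3), (4, 3), (3, 5), (3, 2), (3, 1)]),
    (tuple 1 2 3 4 0, tuple 3 4 0 1 2,
      [(3, 2), (3, 5), (3, 1), (3, 3), (1, 3), (1, 5), (1, 1), (1, 4), (2, 1), (4, 1),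
        (4, 3), (4, 2), (4, 4), (2, 5), (2, 2), (2, 4), (0, 2), (0, 3), (0, 4), (0, 5)]),
    (tuple 1 2 3 4 0, tuple 4 0 1 2 3,
      [(0, 4), (0, 3), (0, 2), (0, 5), (4, 2), (4, 3), (4, 4), (4, 1), (1, 3), (1, 4),
        (1, 5), (1, 1), (2, 4), (3, 3), (2, 5), (2, 2), (3, 1), (2, 1), (3, 2), (3, 5)])]

/-- The pairs covered by the blocks whose entries are fixed by the normalization. -/
def fixedMask (β γ : Fin 5 → Fin 5) : ℕ :=
  (mask 0 0 0 0 0 :: (List.finRange 5).flatMap fun i =>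
    [mask i.succ 0 i.succ i.succ i.succ,
      mask i.succ i.succ 0 (β i).succ (γ i).succ]).foldr Nat.lor 0

set_option maxRecDepth 100000 in
theorem refute_normalForms : ∀ e ∈ normalForms,
    force (fixedMask e.1 e.2.1)
      (refute (e.2.2.map fun p => ((p.1.succ : ℕ), (p.2 : ℕ)))) = true := by
  decide +kernel

theorem normalForms_cells : ∀ e ∈ normalForms,
    (e.2.2.map fun p => 6 * (p.1 : ℕ) + p.2).Nodup ∧ ∀ p ∈ e.2.2, p.2 ≠ 0 ∧ p.2 ≠ p.1.succ := by
  decide +kernel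

theorem not_normalized {e : (Fin 5 → Fin 5) × (Fin 5 → Fin 5) × List (Fin 5 × Fin 6)}
    (he : e ∈ normalForms) (T : Option (Fin 5 × Fin 6) → Fin 5 → Fin 6)
    (hT : ∀ p q, p ≠ q → Separated (T p) (T q)) (hnone : T none = 0)
    (hrow : ∀ p, T (some p) 0 = p.1.succ) (hcol : ∀ p, T (some p) 1 = p.2)
    (hzero : ∀ i, T (some (i, 0)) = ![i.succ, 0, i.succ, i.succ, i.succ])
    (hdiag : ∀ i, T (some (i, i.succ)) = ![i.succ, i.succ, 0, (e.1 i).succ, (e.2.1 i).succ]) :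
    False := by
  obtain ⟨hnodup, hcells⟩ := normalForms_cells e he
  have hrefute := refute_normalForms e he
  have hmap : (e.2.2.map fun p => ((p.1.succ : ℕ), (p.2 : ℕ))) =
      (e.2.2.map fun p => T (some p)).map fun t => ((t 0 : ℕ), (t 1 : ℕ)) := by
    simp [hrow, hcol]
  rw [force_eq, hmap] at hrefute
  refine not_refute _ _ ?_ ?_ hrefute
  · intro t ht
    obtain ⟨p, hp, rfl⟩ := List.mem_map.1 ht
    obtain ⟨hp0, hp1⟩ := hcells p hp
    refine foldr_or_and_eq_zero _ _ fun m hm => ?_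
    simp only [List.mem_cons, List.mem_flatMap, List.mem_finRange, true_and, List.not_mem_nil,
      or_false] at hm
    rcases hm with rfl | ⟨i, rfl | rfl⟩
    · have := (hT none (some p) (by simp)).blockMask_disjoint
      rwa [hnone] at this
    · have := (hT (some (i, 0)) (some p) fun h => hp0 (by simp [← Option.some.inj h])
        ).blockMask_disjoint
      rwa [hzero] at this
    · have := (hT (some (i, i.succ)) (some p) fun h => hp1 (by simp [← Option.some.inj h])
        ).blockMask_disjoint
      rwa [hdiag] at this
  · rw [List.pairwise_map]
    exact hnodup.of_map.imp fun h => (hT _ _ fun h' => h (Option.some.inj h')).blockMask_disjoint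

/-- Candidates for a bijection conjugating `β` to one of the two derangements in normal form. -/
def conjugators (β : Fin 5 → Fin 5) (s t : Fin 5) : List (Fin 5 → Fin 5) :=
  [tuple s (β s) t (β t) (β (β t)), tuple s (β s) (β (β s)) (β (β (β s))) (β (β (β (β s))))]

/-- Representatives of the derangements of five points up to conjugation. -/
def normalDerangements : List (Fin 5 → Fin 5) := [tuple 1 0 3 4 2, tuple 1 2 3 4 0]

/-- The derangement `β` is conjugate to one of the representatives. -/
abbrev HasNormalDerangement (β : Fin 5 → Fin 5) : Prop :=
  ∃ s t, ∃ ρ ∈ conjugators β s t, ∃ β₁ ∈ normalDerangements,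
    (∀ i, ρ (β₁ i) = β (ρ i)) ∧ ∀ i j, ρ i = ρ j → i = j

instance (β : Fin 5 → Fin 5) : Decidable (HasNormalDerangement β) := inferInstance

/-- The pair `β`, `γ` is simultaneously conjugate to a normal form. -/
abbrev HasNormalForm (β γ : Fin 5 → Fin 5) : Prop :=
  ∃ s t, ∃ ρ ∈ conjugators β s t, ∃ e ∈ normalForms,
    (∀ i, ρ (e.1 i) = β (ρ i)) ∧ (∀ i, ρ (e.2.1 i) = γ (ρ i)) ∧ ∀ i j, ρ i = ρ j → i = j

instance (β γ : Fin 5 → Fin 5) : Decidable (HasNormalForm β γ) := inferInstance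

/-- The pair `β`, `γ` has a normal form for every derangement `γ` which is disjoint from `β`. -/
def HasNormalForms (β : Fin 5 → Fin 5) : Prop :=
  ∀ c₀, (c₀ ≠ 0 ∧ c₀ ≠ β 0) → ∀ c₁, (c₁ ≠ 1 ∧ c₁ ≠ β 1 ∧ c₁ ≠ c₀) →
    ∀ c₂, (c₂ ≠ 2 ∧ c₂ ≠ β 2 ∧ c₂ ≠ c₀ ∧ c₂ ≠ c₁) →
    ∀ c₃, (c₃ ≠ 3 ∧ c₃ ≠ β 3 ∧ c₃ ≠ c₀ ∧ c₃ ≠ c₁ ∧ c₃ ≠ c₂) →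
    ∀ c₄, (c₄ ≠ 4 ∧ c₄ ≠ β 4 ∧ c₄ ≠ c₀ ∧ c₄ ≠ c₁ ∧ c₄ ≠ c₂ ∧ c₄ ≠ c₃) →
    HasNormalForm β (tuple c₀ c₁ c₂ c₃ c₄)

instance (β : Fin 5 → Fin 5) : Decidable (HasNormalForms β) := by
  unfold HasNormalForms; infer_instance

theorem hasNormalForms_of_mem : ∀ β ∈ normalDerangements, HasNormalForms β := by
  decide +kernel

set_option synthInstance.maxSize 1000 in
theorem exists_conj_of_derangement_aux :
    ∀ b₀ : Fin 5, b₀ ≠ 0 → ∀ b₁, (b₁ ≠ 1 ∧ b₁ ≠ b₀) → ∀ b₂, (b₂ ≠ 2 ∧ b₂ ≠ b₀ ∧ b₂ ≠ b₁) →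
    ∀ b₃, (b₃ ≠ 3 ∧ b₃ ≠ b₀ ∧ b₃ ≠ b₁ ∧ b₃ ≠ b₂) →
    ∀ b₄, (b₄ ≠ 4 ∧ b₄ ≠ b₀ ∧ b₄ ≠ b₁ ∧ b₄ ≠ b₂ ∧ b₄ ≠ b₃) →
    HasNormalDerangement (tuple b₀ b₁ b₂ b₃ b₄) := by
  decide +kernel

/-- Up to conjugation, every pair of disjoint derangements of five points is a normal form. -/
theorem exists_conj_normalForm {β γ : Fin 5 → Fin 5} (hβ : β.Injective) (hγ : γ.Injective)
    (hβ' : ∀ i, β i ≠ i) (hγ' : ∀ i, γ i ≠ i) (hβγ : ∀ i, β i ≠ γ i) :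
    ∃ e ∈ normalForms, ∃ ρ : Fin 5 → Fin 5, ρ.Injective ∧
      ∀ i, ρ (e.1 i) = β (ρ i) ∧ ρ (e.2.1 i) = γ (ρ i) := by
  have eta : ∀ f : Fin 5 → Fin 5, tuple (f 0) (f 1) (f 2) (f 3) (f 4) = f := fun f => by
    funext i; fin_cases i <;> rfl
  have h := exists_conj_of_derangement_aux (β 0) (hβ' 0) (β 1) (by simp [hβ', hβ.eq_iff])
    (β 2) (by simp [hβ', hβ.eq_iff]) (β 3) (by simp [hβ', hβ.eq_iff])
    (β 4) (by simp [hβ', hβ.eq_iff])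
  rw [eta] at h
  obtain ⟨-, -, ρ, -, β₁, hβ₁, hconj, hρ⟩ := h
  let τ : Fin 5 ≃ Fin 5 := Equiv.ofBijective ρ
    (Finite.injective_iff_bijective.1 fun i j => hρ i j)
  let γ₁ : Fin 5 → Fin 5 := fun i => τ.symm (γ (τ i))
  have hτβ : ∀ i, τ (β₁ i) = β (τ i) := hconj
  have hτγ : ∀ i, τ (γ₁ i) = γ (τ i) := fun i => τ.apply_symm_apply _
  have hinj : γ₁.Injective := τ.symm.injective.comp (hγ.comp τ.injective)
  have hfix : ∀ i, γ₁ i ≠ i := fun i h => hγ' (τ i) (by rw [← hτγ, h])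
  have hne : ∀ i, γ₁ i ≠ β₁ i := fun i h => hβγ (τ i) (by rw [← hτβ, ← hτγ, h])
  have h := hasNormalForms_of_mem β₁ hβ₁ (γ₁ 0) (by simp [hfix, hne]) (γ₁ 1)
    (by simp [hfix, hne, hinj.eq_iff]) (γ₁ 2) (by simp [hfix, hne, hinj.eq_iff])
    (γ₁ 3) (by simp [hfix, hne, hinj.eq_iff]) (γ₁ 4) (by simp [hfix, hne, hinj.eq_iff])
  rw [eta] at h
  obtain ⟨-, -, ρ₁, -, e, he, h₁, h₂, hρ₁⟩ := h
  exact ⟨e, he, τ ∘ ρ₁, τ.injective.comp fun i j => hρ₁ i j, fun i =>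
    ⟨(congrArg τ (h₁ i)).trans (hτβ _), (congrArg τ (h₂ i)).trans (hτγ _)⟩⟩

/-! ### Normalizing an extendable triple -/

/-- The blocks of a triple of rectangles, together with the block `(0, j, a, b, c)` of an additional
cell. -/
def blocks (A B C : Fin 5 → Fin 6 → Fin 6) (j a b c : Fin 6) :
    Option (Fin 5 × Fin 6) → Fin 5 → Fin 6
  | none => ![0, j, a, b, c]
  | some (i, y) => ![i.succ, y, A i y, B i y, C i y]

theorem separated_blocks {A B C : Fin 5 → Fin 6 → Fin 6} {j a b c : Fin 6}
    (hA : IsLatinRectangle A) (hB : IsLatinRectangle B) (hC : IsLatinRectangle C)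
    (hAB : Orthogonal A B) (hAC : Orthogonal A C) (hBC : Orthogonal B C)
    (ha : ∀ i, A i j ≠ a) (hb : ∀ i, B i j ≠ b) (hc : ∀ i, C i j ≠ c)
    (hab : ∀ i j', ¬(A i j' = a ∧ B i j' = b)) (hac : ∀ i j', ¬(A i j' = a ∧ C i j' = c))
    (hbc : ∀ i j', ¬(B i j' = b ∧ C i j' = c)) {p q : Option (Fin 5 × Fin 6)} (hpq : p ≠ q) :
    Separated (blocks A B C j a b c p) (blocks A B C j a b c q) := by
  have key : ∀ p, Separated (blocks A B C j a b c none) (blocks A B C j a b c (some p)) := by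
    rintro ⟨i, y⟩ g h hgh hg hh
    fin_cases g <;> fin_cases h <;> simp [blocks] at hgh hg hh
    all_goals first
      | exact absurd hg (Fin.succ_ne_zero i).symm
      | (subst hg; first | exact ha i hh.symm | exact hb i hh.symm | exact hc i hh.symm)
      | exact hab i y ⟨hg.symm, hh.symm⟩
      | exact hac i y ⟨hg.symm, hh.symm⟩
      | exact hbc i y ⟨hg.symm, hh.symm⟩
  match p, q with
  | none, none => exact absurd rfl hpq
  | none, some q => exact key q
  | some p, none => exact (key p).symm
  | some (i, y), some (i', y') =>
    intro g h hgh hg hh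
    refine hpq (congrArg some ?_)
    fin_cases g <;> fin_cases h <;> simp [blocks] at hgh hg hh
    all_goals first
      | exact Prod.ext hg hh
      | (subst hg; first
          | exact Prod.ext rfl (hA.1 i hh) | exact Prod.ext rfl (hB.1 i hh)
          | exact Prod.ext rfl (hC.1 i hh) | exact Prod.ext (hA.2 y hh) rfl
          | exact Prod.ext (hB.2 y hh) rfl | exact Prod.ext (hC.2 y hh) rfl)
      | exact hAB (Prod.ext hg hh)
      | exact hAC (Prod.ext hg hh)
      | exact hBC (Prod.ext hg hh)

/-- If the entry of `B` in each cell of the symbol `a` of `A` differs from `b`, then it occurs in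
column `j` of `B`, in a row which determines a derangement. -/
theorem exists_derangement {A B : Fin 5 → Fin 6 → Fin 6} {j a b : Fin 6} {κ : Fin 5 → Fin 6}
    (hB : IsLatinRectangle B) (hAB : Orthogonal A B) (ha : ∀ i, A i j ≠ a) (hb : ∀ i, B i j ≠ b)
    (hab : ∀ i j', ¬(A i j' = a ∧ B i j' = b)) (hκ : ∀ i, A i (κ i) = a) :
    ∃ β : Fin 5 → Fin 5, β.Injective ∧ (∀ i, β i ≠ i) ∧ ∀ i, B i (κ i) = B (β i) j := by
  have hinj : Function.Injective (Fin.cons b (fun i => B i j) : Fin 6 → Fin 6) :=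
    Fin.cons_injective_iff.2 ⟨fun ⟨i, hi⟩ => hb i hi, hB.2 j⟩
  have hex : ∀ i, ∃ k, B i (κ i) = B k j := by
    intro i
    obtain ⟨x, hx⟩ := Finite.injective_iff_surjective.1 hinj (B i (κ i))
    cases x using Fin.cases with
    | zero => exact absurd ⟨hκ i, hx.symm⟩ (hab i (κ i))
    | succ k => exact ⟨k, hx.symm⟩
  choose β hβ using hex
  refine ⟨β, fun i k hik => ?_, fun i hi => ?_, hβ⟩
  · have : (i, κ i) = (k, κ k) :=
      hAB (Prod.ext ((hκ i).trans (hκ k).symm) (by simp only [hβ, hik]))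
    exact congrArg Prod.fst this
  · have h := hβ i
    rw [hi] at h
    exact ha i (hB.1 i h ▸ hκ i)

theorem stmt_8 (A B C : Fin 5 → Fin 6 → Fin 6)
    (hA : IsLatinRectangle A) (hB : IsLatinRectangle B) (hC : IsLatinRectangle C)
    (hAB : Orthogonal A B) (hAC : Orthogonal A C) (hBC : Orthogonal B C) :
    ¬ ∃ (j : Fin 6) (a b c : Fin 6),
      (∀ i, A i j ≠ a) ∧ (∀ i, B i j ≠ b) ∧ (∀ i, C i j ≠ c) ∧
      (∀ i j', ¬(A i j' = a ∧ B i j' = b)) ∧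
      (∀ i j', ¬(A i j' = a ∧ C i j' = c)) ∧
      (∀ i j', ¬(B i j' = b ∧ C i j' = c)) := by
  rintro ⟨j, a, b, c, ha, hb, hc, hab, hac, hbc⟩
  choose κ hκ using fun i => Finite.injective_iff_surjective.1 (hA.1 i) a
  obtain ⟨β, hβinj, hβne, hβ⟩ := exists_derangement hB hAB ha hb hab hκ
  obtain ⟨γ, hγinj, hγne, hγ⟩ := exists_derangement hC hAC ha hc hac hκ
  have hβγ : ∀ i, β i ≠ γ i := by
    intro i h
    have h' : (i, κ i) = (β i, j) := hBC (Prod.ext (hβ i) ((hγ i).trans (by simp only [h])))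
    exact hβne i (congrArg Prod.fst h').symm
  obtain ⟨e, he, ρ, hρ, hconj⟩ := exists_conj_normalForm hβinj hγinj hβne hγne hβγ
  have hκinj : κ.Injective := fun i k h => hA.2 (κ i) <| by
    change A i (κ i) = A k (κ i)
    rw [hκ i, h, hκ k]
  set S := blocks A B C j a b c with hS
  let f : Fin 5 → Fin 5 → Fin 6 :=
    ![Fin.succ, κ, fun i => A i j, fun i => B i j, fun i => C i j]
  have hf : ∀ g, Function.Injective
      (Fin.cons (S none g) (fun i => f g (ρ i)) : Fin 6 → Fin 6) := by
    intro g
    rw [Fin.cons_injective_iff]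
    fin_cases g
    · exact ⟨fun ⟨i, hi⟩ => Fin.succ_ne_zero _ hi, (Fin.succ_injective 5).comp hρ⟩
    · exact ⟨fun ⟨i, hi⟩ => ha (ρ i) (by rw [← hκ (ρ i)]; exact congrArg _ hi.symm),
        hκinj.comp hρ⟩
    · exact ⟨fun ⟨i, hi⟩ => ha _ hi, (hA.2 j).comp hρ⟩
    · exact ⟨fun ⟨i, hi⟩ => hb _ hi, (hB.2 j).comp hρ⟩
    · exact ⟨fun ⟨i, hi⟩ => hc _ hi, (hC.2 j).comp hρ⟩
  let σ : Fin 5 → Fin 6 ≃ Fin 6 := fun g =>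
    Equiv.ofBijective _ (Finite.injective_iff_bijective.1 (hf g))
  let reindex : Option (Fin 5 × Fin 6) → Option (Fin 5 × Fin 6) :=
    Option.map (Prod.map ρ (σ 1))
  have hreindex : reindex.Injective := Option.map_injective (hρ.prodMap (σ 1).injective)
  refine not_normalized he (fun p g => (σ g).symm (S (reindex p) g)) ?_ ?_ ?_ ?_ ?_ ?_
  · intro p q hpq g h hgh hg hh
    exact separated_blocks hA hB hC hAB hAC hBC ha hb hc hab hac hbc (hreindex.ne hpq) g h hgh
      ((σ g).symm.injective hg) ((σ h).symm.injective hh)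
  · funext g
    exact (σ g).symm_apply_eq.2 rfl
  · exact fun p => (σ 0).symm_apply_eq.2 rfl
  · exact fun p => (σ 1).symm_apply_eq.2 rfl
  · intro i
    funext g
    refine (σ g).symm_apply_eq.2 ?_
    fin_cases g <;> rfl
  · intro i
    have hcell : reindex (some (i, i.succ)) = some (ρ i, κ (ρ i)) := rfl
    funext g
    refine (σ g).symm_apply_eq.2 ?_
    rw [hcell]
    fin_cases g
    · rfl
    · rfl
    · exact hκ (ρ i)
    · exact (hβ (ρ i)).trans (congrArg (fun k => B k j) (hconj i).1.symm)
    · exact (hγ (ρ i)).trans (congrArg (fun k => C k j) (hconj i).2.symm)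
end

section
/- Up to isotopism, there are exactly 7 triples of mutually orthogonal 5 × 6 Latin rectangles; that is, the isotopism equivalence relation partitions the set of triples of mutually orthogonal 5 × 6 Latin rectangles into exactly 7 classes. -/
/-- A triple of mutually orthogonal `k × n` Latin rectangles, indexed by `Fin 3`. -/
def IsMOLRTriple {k n : ℕ} (M : Fin 3 → Fin k → Fin n → Fin n) : Prop :=
  (∀ s, IsLatinRectangle (M s)) ∧ ∀ s t, s ≠ t → Orthogonal (M s) (M t)

/-- Two triples are isotopic: one is obtained from the other by permuting the order
of the three rectangles, a common row permutation, a common column permutation, and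
a separate symbol permutation in each rectangle. -/
def Isotopic {k n : ℕ} (M M' : Fin 3 → Fin k → Fin n → Fin n) : Prop :=
  ∃ (ρ : Equiv.Perm (Fin 3)) (σr : Equiv.Perm (Fin k)) (σc : Equiv.Perm (Fin n))
    (f : Fin 3 → Equiv.Perm (Fin n)),
    ∀ s i j, M' s i j = f s (M (ρ s) (σr i) (σc j))

namespace LatinTriple

open Equiv

set_option exponentiation.threshold 2000

/-! ### Bit masks

A cell of a triple in column `c` with symbols `a`, `b`, `g` is encoded by the number
`code c a b g < 6 * 256`, and a set of such words by the natural number having these bits. -/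

/-- The number whose binary expansion is `x` repeated `n` times with period `k`. -/
def repeatBits (x k n : ℕ) : ℕ :=
  Nat.mul x (Nat.div (Nat.sub (Nat.pow 2 (Nat.mul k n)) 1) (Nat.sub (Nat.pow 2 k) 1))

def colBase : ℕ := Nat.sub (Nat.pow 2 216) 1

def symBase₀ : ℕ := repeatBits (Nat.sub (Nat.pow 2 36) 1) 256 6

def symBase₁ : ℕ := repeatBits (repeatBits 63 36 6) 256 6

def symBase₂ : ℕ := repeatBits (repeatBits 1 6 36) 256 6

/-- The set of all words. -/
def full : ℕ := repeatBits colBase 256 6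

/-- The set of all words outside column `0`. -/
def offFirst : ℕ := Nat.sub full colBase

/-- Words in column `c`. -/
def colMask (c : ℕ) : ℕ := Nat.shiftLeft colBase (Nat.mul 256 c)

def symMask₀ (a : ℕ) : ℕ := Nat.shiftLeft symBase₀ (Nat.mul 36 a)

def symMask₁ (b : ℕ) : ℕ := Nat.shiftLeft symBase₁ (Nat.mul 6 b)

def symMask₂ (g : ℕ) : ℕ := Nat.shiftLeft symBase₂ g

def code (c a b g : ℕ) : ℕ :=
  Nat.add (Nat.add (Nat.mul 256 c) (Nat.mul 36 a)) (Nat.add (Nat.mul 6 b) g)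

/-- Words that may occur in the same row as the given word. -/
def sameRow (c a b g : ℕ) : ℕ :=
  Nat.xor full (Nat.lor (Nat.lor (colMask c) (symMask₀ a)) (Nat.lor (symMask₁ b) (symMask₂ g)))

/-- Words that may occur in another row than the given word. -/
def otherRow (c a b g : ℕ) : ℕ :=
  Nat.xor full (Nat.lor
    (Nat.lor (Nat.land (colMask c) (symMask₀ a)) (Nat.land (symMask₁ b) (symMask₂ g)))
    (Nat.land (Nat.lor (colMask c) (symMask₀ a)) (Nat.lor (symMask₁ b) (symMask₂ g))))

/-- Adding `carry` to a set of words sets the top bit of each nonempty column. -/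
def carry : ℕ := repeatBits (Nat.sub (Nat.pow 2 255) 1) 256 6

/-- The top bits of the columns from `c` on. -/
def guard (c : ℕ) : ℕ :=
  Nat.shiftLeft (repeatBits (Nat.pow 2 255) 256 (Nat.sub 6 c)) (Nat.mul 256 c)

theorem testBit_land (x y i : ℕ) : (Nat.land x y).testBit i = (x.testBit i && y.testBit i) :=
  Nat.testBit_and x y i

theorem testBit_lor (x y i : ℕ) : (Nat.lor x y).testBit i = (x.testBit i || y.testBit i) :=
  Nat.testBit_or x y i

theorem testBit_xor (x y i : ℕ) : (Nat.xor x y).testBit i = (x.testBit i ^^ y.testBit i) :=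
  Nat.testBit_xor x y i

theorem beq_land_two_pow {x i : ℕ} (h : x.testBit i = true) :
    Nat.beq (Nat.land x (Nat.pow 2 i)) 0 = false := by
  have : (Nat.land x (Nat.pow 2 i)).testBit i = true := by
    rw [testBit_land, h]; simp
  rw [← Bool.not_eq_true, Nat.beq_eq]
  intro h0
  rw [h0, Nat.zero_testBit] at this
  exact absurd this (by decide)

theorem beq_land_of_testBit {x y i : ℕ} (hx : x.testBit i = true) (hy : y.testBit i = true) :
    Nat.beq (Nat.land x y) 0 = false := by
  rw [← Bool.not_eq_true, Nat.beq_eq]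
  intro h0
  have := testBit_land x y i
  rw [h0, hx, hy, Nat.zero_testBit] at this
  exact absurd this (by decide)

theorem testBit_repeatBits {x k : ℕ} (hk : 0 < k) (hx : x < 2 ^ k) (n i : ℕ) :
    (repeatBits x k n).testBit i = (decide (i < k * n) && x.testBit (i % k)) := by
  have h2 : 2 ≤ 2 ^ k := Nat.le_self_pow hk.ne' 2
  have hsum : repeatBits x k n = x * ∑ i ∈ Finset.range n, (2 ^ k) ^ i := by
    rw [Nat.geomSum_eq h2, ← pow_mul]; rfl
  rw [hsum]
  clear hsum
  induction n generalizing i with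
  | zero => simp
  | succ n ih =>
    rw [geom_sum_succ, Nat.mul_add, mul_one, Nat.mul_left_comm, Nat.testBit_two_pow_mul_add _ hx]
    split_ifs with h
    · rw [Nat.mod_eq_of_lt h, decide_eq_true (by nlinarith), Bool.true_and]
    · rw [ih, ← Nat.mod_eq_sub_mod (not_lt.mp h), Nat.mul_succ]
      congr 2
      exact propext ⟨by omega, by omega⟩

theorem testBit_shiftLeft (x k i : ℕ) :
    (Nat.shiftLeft x k).testBit i = (decide (k ≤ i) && x.testBit (i - k)) :=
  Nat.testBit_shiftLeft x

theorem testBit_colBase (i : ℕ) : colBase.testBit i = decide (i < 216) :=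
  Nat.testBit_two_pow_sub_one 216 i

theorem testBit_full (i : ℕ) : full.testBit i = (decide (i < 1536) && decide (i % 256 < 216)) := by
  rw [full, testBit_repeatBits (by norm_num) (by decide +kernel), testBit_colBase]

theorem testBit_symBase₀ (i : ℕ) :
    symBase₀.testBit i = (decide (i < 1536) && decide (i % 256 < 36)) := by
  rw [symBase₀, testBit_repeatBits (by norm_num) (by decide +kernel)]
  exact congrArg _ (Nat.testBit_two_pow_sub_one 36 _)

theorem testBit_symBase₁ (i : ℕ) : symBase₁.testBit i =
    (decide (i < 1536) && (decide (i % 256 < 216) && decide (i % 256 % 36 < 6))) := by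
  rw [symBase₁, testBit_repeatBits (by norm_num) (by decide +kernel),
    testBit_repeatBits (by norm_num) (by decide +kernel)]
  exact congrArg _ (congrArg _ (Nat.testBit_two_pow_sub_one 6 _))

theorem testBit_symBase₂ (i : ℕ) : symBase₂.testBit i =
    (decide (i < 1536) && (decide (i % 256 < 216) && decide (i % 256 % 6 = 0))) := by
  rw [symBase₂, testBit_repeatBits (by norm_num) (by decide +kernel),
    testBit_repeatBits (by norm_num) (by decide +kernel), ← pow_zero 2, Nat.testBit_two_pow]
  simp only [eq_comm]

theorem code_eq (c a b g : ℕ) : code c a b g = 256 * c + 36 * a + (6 * b + g) := rfl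

theorem add_sub_mod_256 {c t d : ℕ} (ht : t < 256) (hd : d < 256) (h : d ≤ 256 * c + t) :
    d ≤ t ∧ (256 * c + t - d) % 256 = t - d ∨ t < d ∧ (256 * c + t - d) % 256 = 256 + t - d := by
  omega

theorem testBit_full_code (c a b g : Fin 6) : full.testBit (code c a b g) = true := by
  rw [testBit_full, code_eq, add_assoc]
  obtain ⟨t, ht⟩ : ∃ t : ℕ, 36 * (a : ℕ) + (6 * b + g) = t := ⟨_, rfl⟩
  rw [ht, Nat.mul_add_mod, Bool.and_eq_true, decide_eq_true_eq, decide_eq_true_eq]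
  omega

theorem testBit_colMask (x c a b g : Fin 6) :
    (colMask x).testBit (code c a b g) = decide (x = c) := by
  rw [colMask, testBit_shiftLeft, testBit_colBase, code_eq, ← Bool.decide_and]
  refine decide_eq_decide.2 ?_
  rw [show Nat.mul 256 x = 256 * x from rfl, Fin.ext_iff]
  omega

theorem testBit_symMask₀ (x c a b g : Fin 6) :
    (symMask₀ x).testBit (code c a b g) = decide (x = a) := by
  rw [symMask₀, testBit_shiftLeft, testBit_symBase₀, code_eq, add_assoc]
  simp only [← Bool.decide_and]
  refine decide_eq_decide.2 ?_
  rw [show Nat.mul 36 x = 36 * x from rfl, Fin.ext_iff]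
  constructor
  · rintro ⟨h, -, h'⟩
    have := add_sub_mod_256 (by omega) (by omega) h
    omega
  · intro h
    refine ⟨by omega, by omega, ?_⟩
    have := add_sub_mod_256 (c := c) (t := 36 * a + (6 * b + g)) (d := 36 * x) (by omega)
      (by omega) (by omega)
    omega

theorem testBit_symMask₁ (x c a b g : Fin 6) :
    (symMask₁ x).testBit (code c a b g) = decide (x = b) := by
  rw [symMask₁, testBit_shiftLeft, testBit_symBase₁, code_eq, add_assoc]
  simp only [← Bool.decide_and]
  refine decide_eq_decide.2 ?_
  rw [show Nat.mul 6 x = 6 * x from rfl, Fin.ext_iff]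
  constructor
  · rintro ⟨h, -, h₁, h₂⟩
    have := add_sub_mod_256 (by omega) (by omega) h
    omega
  · intro h
    have := add_sub_mod_256 (c := c) (t := 36 * a + (6 * b + g)) (d := 6 * x) (by omega)
      (by omega) (by omega)
    refine ⟨by omega, by omega, by omega, ?_⟩
    omega

theorem testBit_symMask₂ (x c a b g : Fin 6) :
    (symMask₂ x).testBit (code c a b g) = decide (x = g) := by
  rw [symMask₂, testBit_shiftLeft, testBit_symBase₂, code_eq, add_assoc]
  simp only [← Bool.decide_and]
  refine decide_eq_decide.2 ?_
  rw [Fin.ext_iff]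
  constructor
  · rintro ⟨h, -, h₁, h₂⟩
    have := add_sub_mod_256 (by omega) (by omega) h
    omega
  · intro h
    have := add_sub_mod_256 (c := c) (t := 36 * a + (6 * b + g)) (d := x) (by omega)
      (by omega) (by omega)
    refine ⟨by omega, by omega, by omega, ?_⟩
    omega

theorem testBit_sameRow {c a b g c' a' b' g' : Fin 6} (hc : c ≠ c') (ha : a ≠ a') (hb : b ≠ b')
    (hg : g ≠ g') : (sameRow c a b g).testBit (code c' a' b' g') = true := by
  simp [sameRow, testBit_full_code, testBit_colMask, testBit_symMask₀,
    testBit_symMask₁, testBit_symMask₂, hc, ha, hb, hg]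

theorem testBit_otherRow {c a b g c' a' b' g' : Fin 6} (h₁ : c = c' → a ≠ a')
    (h₂ : c = c' → b ≠ b') (h₃ : c = c' → g ≠ g') (h₄ : a = a' → b ≠ b') (h₅ : a = a' → g ≠ g')
    (h₆ : b = b' → g ≠ g') : (otherRow c a b g).testBit (code c' a' b' g') = true := by
  simp only [otherRow, testBit_xor, testBit_lor, testBit_land, testBit_full_code, testBit_colMask,
    testBit_symMask₀, testBit_symMask₁, testBit_symMask₂]
  by_cases hc : c = c' <;> by_cases ha : a = a' <;> by_cases hb : b = b' <;>
    by_cases hg : g = g' <;> simp_all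

/-- All bits of `X` lie below position `216` of their column. -/
def Small (X : ℕ) : Prop := ∀ k, X.testBit k = true → k % 256 < 216

theorem Small.land {X : ℕ} (h : Small X) (Y : ℕ) : Small (Nat.land X Y) := fun k hk =>
  h k (by rw [testBit_land, Bool.and_eq_true] at hk; exact hk.1)

theorem small_full : Small full := fun k hk => by
  rw [testBit_full, Bool.and_eq_true, decide_eq_true_eq, decide_eq_true_eq] at hk
  exact hk.2

theorem testBit_add_carry {X c v : ℕ} (hX : Small X) (hc : c < 6) (hv : v < 216)
    (h : X.testBit (256 * c + v) = true) : (X + carry).testBit (256 * c + 255) = true := by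
  obtain ⟨B, hB⟩ : ∃ B, B = 2 ^ (256 * c) := ⟨_, rfl⟩
  have hBpos : 0 < B := hB ▸ Nat.two_pow_pos _
  have hcarry : carry / B % 2 ^ 256 = 2 ^ 255 - 1 := by
    rw [hB]
    have : ∀ c < 6, carry / 2 ^ (256 * c) % 2 ^ 256 = 2 ^ 255 - 1 := by decide +kernel
    exact this c hc
  have hbit : ∀ j, (X / B % 2 ^ 256).testBit j = (decide (j < 256) && X.testBit (256 * c + j)) := by
    intro j
    rw [Nat.testBit_mod_two_pow, hB, Nat.testBit_div_two_pow, Nat.add_comm]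
  have hlt : X / B % 2 ^ 256 < 2 ^ 255 := by
    apply Nat.lt_pow_two_of_testBit
    intro j hj
    rw [hbit, Bool.eq_false_iff]
    intro hc'
    simp only [Bool.and_eq_true, decide_eq_true_eq] at hc'
    have := hX _ hc'.2
    omega
  have hpos : 0 < X / B % 2 ^ 256 := by
    rw [Nat.pos_iff_ne_zero]
    intro h0
    have := hbit v
    rw [h0, h, Nat.zero_testBit, decide_eq_true (show v < 256 by omega)] at this
    exact absurd this (by decide)
  have hadd : (X + carry) / B = X / B + carry / B ∨ (X + carry) / B = X / B + carry / B + 1 := by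
    rw [Nat.add_div hBpos]; split <;> simp
  rw [Nat.testBit_eq_decide_div_mod_eq, decide_eq_true_eq, Nat.pow_add, ← Nat.div_div_eq_div_mul,
    ← hB]
  norm_num at hlt hpos hcarry ⊢
  generalize (X + carry) / B = z at *
  generalize X / B = x at *
  generalize carry / B = y at *
  omega

theorem guard_check {X c : ℕ} (hX : Small X) (hc : c ≤ 6)
    (h : ∀ d, c ≤ d → d < 6 → ∃ v < 216, X.testBit (256 * d + v) = true) :
    Nat.beq (Nat.land (Nat.add X carry) (guard c)) (guard c) = true := by
  rw [Nat.beq_eq]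
  refine Nat.eq_of_testBit_eq fun k => ?_
  rw [testBit_land]
  cases hk : (guard c).testBit k with
  | false => simp
  | true =>
    rw [guard, testBit_shiftLeft, testBit_repeatBits (by norm_num) (by decide +kernel),
      show Nat.pow 2 255 = 2 ^ 255 from rfl, Nat.testBit_two_pow] at hk
    simp only [Bool.and_eq_true, decide_eq_true_eq, show Nat.mul 256 c = 256 * c from rfl,
      show Nat.sub 6 c = 6 - c from rfl] at hk
    obtain ⟨v, hv, hb⟩ := h (k / 256) (by omega) (by omega)
    have := testBit_add_carry hX (by omega) hv hb
    rw [show 256 * (k / 256) + 255 = k by omega] at this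
    rw [Bool.and_true]
    exact this

/-! ### The backtracking search -/

/-- A list of words, each with its bit and its masks of compatible words. -/
inductive WordList
  | nil
  | cons (word bit same other : ℕ) (tail : WordList)

/-- The words of a column, grouped by their first symbol. -/
inductive Column
  | nil
  | cons (mask : ℕ) (words : WordList) (tail : Column)

/-- A list of columns; `rest` is the guard of the columns not yet filled. -/
inductive Columns
  | nil
  | cons (column : Column) (rest : ℕ) (tail : Columns)

/-- `f (n - 1) (⋯ (f 1 (f 0 z)))`. -/
noncomputable def iter {β : Type} (n : ℕ) (z : β) (f : ℕ → β → β) : β :=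
  Nat.rec z (fun k ih => f k ih) n

/-- `if b then x else y`, for evaluation in the kernel. -/
noncomputable def sel {β : Type} (b : Bool) (x y : β) : β := Bool.rec y x b

noncomputable def wordList (c a S : ℕ) : WordList :=
  iter 6 .nil fun b l => iter 6 l fun g l =>
    sel (Nat.beq (Nat.land S (Nat.pow 2 (code c a b g))) 0) l
      (.cons (code c a b g) (Nat.pow 2 (code c a b g)) (sameRow c a b g) (otherRow c a b g) l)

noncomputable def column (c S : ℕ) : Column :=
  iter 6 .nil fun a l =>
    sel (Nat.beq (Nat.land S (Nat.land (colMask c) (symMask₀ a))) 0) l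
      (.cons (Nat.land (colMask c) (symMask₀ a)) (wordList c a S) l)

/-- The words in `S`, arranged by columns. -/
noncomputable def columns (S : ℕ) : Columns :=
  .cons (column 0 S) (guard 0) <| .cons (column 1 S) (guard 1) <| .cons (column 2 S) (guard 2) <|
    .cons (column 3 S) (guard 3) <| .cons (column 4 S) (guard 4) <|
    .cons (column 5 S) (guard 5) .nil

noncomputable def forWordList (k : ℕ → ℕ → ℕ → ℕ → Bool) (R : ℕ) (l : WordList) : Bool :=
  WordList.rec true (fun w bit same other _ ih =>
    sel (Nat.beq (Nat.land R bit) 0) ih (sel (k w bit same other) ih false)) l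

/-- Whether `k` holds for all words of the column that belong to `R`. -/
noncomputable def forColumn (k : ℕ → ℕ → ℕ → ℕ → Bool) (R : ℕ) (l : Column) : Bool :=
  Column.rec true (fun mask l _ ih =>
    sel (Nat.beq (Nat.land R mask) 0) ih (sel (forWordList k R l) ih false)) l

noncomputable def push (acc w : ℕ) : ℕ := Nat.add (Nat.mul 2048 acc) w

/-- Whether all columns selected by the guard `H` contain an element of `X`. -/
noncomputable def meets (X H : ℕ) : Bool := Nat.beq (Nat.land (Nat.add X carry) H) H

/-- Fills the given columns of a row with words in `R`, keeping in `N` the words that are still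
possible in later rows, and checks `k` on every result. -/
noncomputable def fill (need : ℕ) (k : ℕ → ℕ → Bool) (cs : Columns) : ℕ → ℕ → ℕ → Bool :=
  Columns.rec (fun _ N acc => k N acc)
    (fun col rest _ ih R N acc =>
      sel (meets R rest) (sel (meets N need) (forColumn (fun w _ same other =>
        ih (Nat.land R same) (Nat.land N other) (push acc w)) R col) true) true) cs

/-- Fills a row; the words in column `0` of later rows have to be smaller than the one chosen
here. -/
noncomputable def fillRow (need : ℕ) (k : ℕ → ℕ → Bool) (cs : Columns) (N acc : ℕ) : Bool :=
  Columns.rec true (fun col _ cs _ => forColumn (fun w bit same other =>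
    fill need k cs (Nat.land N same)
      (Nat.land (Nat.land N other) (Nat.lor offFirst (Nat.sub bit 1))) (push acc w)) N col) cs

/-- Fills `n` rows. -/
noncomputable def fillRows (leaf : ℕ → Bool) (cs : Columns) (n : ℕ) : ℕ → ℕ → Bool :=
  Nat.rec (fun _ acc => leaf acc)
    (fun n ih N acc => fillRow (Nat.rec 0 (fun _ _ => guard 0) n) ih cs N acc) n

/-- Fills row `1`, where columns and the symbols of the first two rectangles are prescribed. -/
noncomputable def fillSecond (k : ℕ → ℕ → Bool) (l : List (ℕ × ℕ × ℕ)) : ℕ → ℕ → ℕ → Bool :=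
  List.rec (fun _ N acc => k N acc) (fun cab _ ih R N acc =>
    (fun c a b => iter 6 true fun g r =>
      sel (Nat.beq (Nat.land R (Nat.pow 2 (code c a b g))) 0) r
        (sel (ih (Nat.land R (sameRow c a b g)) (Nat.land N (otherRow c a b g))
          (push acc (code c a b g))) r false)) cab.1 cab.2.1 cab.2.2) l

/-- The words compatible with row `0` being the identity. -/
noncomputable def afterFirst : ℕ :=
  iter 6 full fun i S => Nat.land S (otherRow i i i i)

noncomputable def firstRow : ℕ :=
  push (push (push (push (push (push 0 (code 0 0 0 0)) (code 1 1 1 1)) (code 2 2 2 2))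
    (code 3 3 3 3)) (code 4 4 4 4)) (code 5 5 5 5)

/-- Checks `leaf` on all triples with row `0` the identity, the given symbols in row `1`, and
rows `2`, `3`, `4` in decreasing order. -/
noncomputable def search (leaf : ℕ → Bool) (l : List (ℕ × ℕ × ℕ)) : Bool :=
  fillSecond (fun N acc => (fun cs => fillRows leaf cs 3 N acc) (columns N)) l afterFirst afterFirst
    firstRow

/-! ### Correctness of the search -/

/-- A row of a triple: the symbol of the `s`-th rectangle in column `c`. -/
abbrev Row := Fin 3 → Fin 6 → Fin 6

def Row.word (r : Row) (c : Fin 6) : ℕ := code c (r 0 c) (r 1 c) (r 2 c)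

def Row.same (r : Row) (c : Fin 6) : ℕ := sameRow c (r 0 c) (r 1 c) (r 2 c)

def Row.other (r : Row) (c : Fin 6) : ℕ := otherRow c (r 0 c) (r 1 c) (r 2 c)

structure Row.Compatible (r r' : Row) : Prop where
  column : ∀ s c, r s c ≠ r' s c
  symbol : ∀ s t, s ≠ t → ∀ c c', r s c = r' s c' → r t c ≠ r' t c'

theorem Row.testBit_same {r : Row} (hr : ∀ s, Function.Injective (r s)) {c c' : Fin 6}
    (h : c ≠ c') : (r.same c).testBit (r.word c') = true :=
  testBit_sameRow h ((hr 0).ne h) ((hr 1).ne h) ((hr 2).ne h)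

theorem Row.Compatible.testBit_other {r r' : Row} (h : r.Compatible r') (c c' : Fin 6) :
    (r.other c).testBit (r'.word c') = true :=
  testBit_otherRow (by rintro rfl; exact h.column _ _) (by rintro rfl; exact h.column _ _)
    (by rintro rfl; exact h.column _ _) (h.symbol 0 1 (by decide) _ _)
    (h.symbol 0 2 (by decide) _ _) (h.symbol 1 2 (by decide) _ _)

theorem iter_of_step {β : Type} {P : β → Prop} {n i : ℕ} (hi : i < n) (z : β) {f : ℕ → β → β}
    (hf : ∀ k b, P b → P (f k b)) (h : ∀ b, P (f i b)) : P (iter n z f) := by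
  induction n with
  | zero => omega
  | succ n ih =>
    change P (f n (iter n z f))
    rcases Nat.lt_succ_iff_lt_or_eq.mp hi with h' | rfl
    · exact hf _ _ (ih h')
    · exact h _

theorem iter_of_start {β : Type} {P : β → Prop} (n : ℕ) {z : β} {f : ℕ → β → β}
    (hf : ∀ k b, P b → P (f k b)) (h : P z) : P (iter n z f) := by
  induction n with
  | zero => exact h
  | succ n ih => exact hf _ _ ih

def WordList.Mem (c a b g : ℕ) : WordList → Prop
  | nil => False
  | cons w bit same other tl => (w = code c a b g ∧ bit = Nat.pow 2 (code c a b g) ∧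
      same = sameRow c a b g ∧ other = otherRow c a b g) ∨ tl.Mem c a b g

def Column.Mem (c a b g : ℕ) : Column → Prop
  | nil => False
  | cons mask l tl => (mask.testBit (code c a b g) = true ∧ l.Mem c a b g) ∨ tl.Mem c a b g

theorem wordList_mem {c a b g : Fin 6} {S : ℕ} (h : S.testBit (code c a b g) = true) :
    (wordList c a S).Mem c a b g := by
  have step : ∀ (b' g' : ℕ) (l : WordList), l.Mem c a b g → WordList.Mem c a b g
      (sel (Nat.beq (Nat.land S (Nat.pow 2 (code c a b' g'))) 0) l (.cons (code c a b' g')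
        (Nat.pow 2 (code c a b' g')) (sameRow c a b' g') (otherRow c a b' g') l)) := by
    intro b' g' l hl
    cases Nat.beq (Nat.land S (Nat.pow 2 (code c a b' g'))) 0
    · exact Or.inr hl
    · exact hl
  refine iter_of_step (P := WordList.Mem c a b g) b.isLt _ (fun b' l hl => ?_) (fun l => ?_)
  · exact iter_of_start (P := WordList.Mem c a b g) 6 (fun g' l hl => step b' g' l hl) hl
  · refine iter_of_step (P := WordList.Mem c a b g) g.isLt _ (fun g' l hl => step b g' l hl)
      fun l => ?_
    rw [beq_land_two_pow h]
    exact Or.inl ⟨rfl, rfl, rfl, rfl⟩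

theorem column_mem {c a b g : Fin 6} {S : ℕ} (h : S.testBit (code c a b g) = true) :
    (column c S).Mem c a b g := by
  have hm : (Nat.land (colMask c) (symMask₀ a)).testBit (code c a b g) = true := by
    rw [testBit_land, testBit_colMask, testBit_symMask₀]; simp
  refine iter_of_step (P := Column.Mem c a b g) a.isLt _ (fun a' l hl => ?_) (fun l => ?_)
  · cases Nat.beq (Nat.land S (Nat.land (colMask c) (symMask₀ a'))) 0
    · exact Or.inr hl
    · exact hl
  · rw [beq_land_of_testBit h hm]
    exact Or.inl ⟨hm, wordList_mem h⟩

theorem sel_false {b x : Bool} : sel b x false = true ↔ b = true ∧ x = true := by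
  cases b <;> simp [sel]

theorem sel_sel {b k x : Bool} (h : sel b x (sel k x false) = true) : x = true := by
  cases b
  · exact (sel_false.mp h).2
  · exact h

theorem forWordList_spec {k : ℕ → ℕ → ℕ → ℕ → Bool} {R : ℕ} {c a b g : ℕ}
    (hR : R.testBit (code c a b g) = true) {l : WordList} (hl : l.Mem c a b g)
    (h : forWordList k R l = true) :
    k (code c a b g) (Nat.pow 2 (code c a b g)) (sameRow c a b g) (otherRow c a b g) = true := by
  induction l with
  | nil => exact hl.elim
  | cons w bit same other tl ih =>
    change sel (Nat.beq (Nat.land R bit) 0) (forWordList k R tl)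
      (sel (k w bit same other) (forWordList k R tl) false) = true at h
    rcases hl with ⟨rfl, rfl, rfl, rfl⟩ | hl
    · rw [beq_land_two_pow hR] at h
      exact (sel_false.mp h).1
    · exact ih hl (sel_sel h)

theorem forColumn_spec {k : ℕ → ℕ → ℕ → ℕ → Bool} {R : ℕ} {c a b g : ℕ}
    (hR : R.testBit (code c a b g) = true) {l : Column} (hl : l.Mem c a b g)
    (h : forColumn k R l = true) :
    k (code c a b g) (Nat.pow 2 (code c a b g)) (sameRow c a b g) (otherRow c a b g) = true := by
  induction l with
  | nil => exact hl.elim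
  | cons mask l tl ih =>
    change sel (Nat.beq (Nat.land R mask) 0) (forColumn k R tl)
      (sel (forWordList k R l) (forColumn k R tl) false) = true at h
    rcases hl with ⟨hm, hl⟩ | hl
    · rw [beq_land_of_testBit hR hm] at h
      exact forWordList_spec hR hl (sel_false.mp h).1
    · exact ih hl (sel_sel h)

/-- The columns `l` up to column `5` contain all words of the rows in `F`. -/
def Columns.Covers (F : List Row) : Columns → List (Fin 6) → Prop
  | nil, [] => True
  | cons col rest tl, c :: l => rest = guard c ∧ (∀ d, c ≤ d → d ∈ c :: l) ∧
      (∀ r ∈ F, col.Mem c (r 0 c) (r 1 c) (r 2 c)) ∧ tl.Covers F l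
  | _, _ => False

theorem columns_covers {F : List Row} {S : ℕ} (h : ∀ r ∈ F, ∀ c, S.testBit (r.word c) = true) :
    (columns S).Covers F [0, 1, 2, 3, 4, 5] :=
  ⟨rfl, by decide, fun r hr => column_mem (h r hr 0), rfl, by decide,
    fun r hr => column_mem (h r hr 1), rfl, by decide, fun r hr => column_mem (h r hr 2), rfl,
    by decide, fun r hr => column_mem (h r hr 3), rfl, by decide,
    fun r hr => column_mem (h r hr 4), rfl, by decide, fun r hr => column_mem (h r hr 5), trivial⟩

theorem meets_zero (X : ℕ) : meets X 0 = true := by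
  have : ∀ Y, Nat.beq (Nat.land Y 0) 0 = true := fun Y => Nat.beq_eq.symm ▸ Nat.and_zero Y
  exact this _

theorem guard_check_row {X : ℕ} (hX : Small X) {c : Fin 6} (r : Row)
    (h : ∀ d, c ≤ d → X.testBit (r.word d) = true) :
    meets X (guard c) = true := by
  refine guard_check hX c.isLt.le fun d hcd hd => ⟨36 * (r 0 ⟨d, hd⟩ : ℕ) + (6 * (r 1 ⟨d, hd⟩ : ℕ) +
    (r 2 ⟨d, hd⟩ : ℕ)), by omega, ?_⟩
  rw [← add_assoc]
  exact h ⟨d, hd⟩ hcd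

theorem fill_spec {need : ℕ} {k : ℕ → ℕ → Bool} {F F' : List Row} {r : Row} (hrF : r ∈ F)
    (hr : ∀ s, Function.Injective (r s)) (hF' : ∀ f ∈ F', r.Compatible f)
    (hneed : need = 0 ∨ need = guard 0 ∧ F' ≠ []) {l : List (Fin 6)} (hl : l.Nodup) {cs : Columns}
    (hcs : cs.Covers F l) {R N acc : ℕ} (hRs : Small R) (hNs : Small N)
    (hR : ∀ c ∈ l, R.testBit (r.word c) = true)
    (hN : ∀ f ∈ F', ∀ c, N.testBit (f.word c) = true) (h : fill need k cs R N acc = true) :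
    ∃ N', Small N' ∧ (∀ f ∈ F', ∀ c, N'.testBit (f.word c) = true) ∧
      k N' ((l.map r.word).foldl push acc) = true := by
  induction l generalizing cs R N acc with
  | nil =>
    cases cs with
    | nil => exact ⟨N, hNs, hN, h⟩
    | cons => exact hcs.elim
  | cons c l ih =>
    cases cs with
    | nil => exact hcs.elim
    | cons col rest tl =>
      obtain ⟨rfl, hsuf, hmem, htl⟩ := hcs
      change sel (meets R (guard c)) (sel (meets N need) (forColumn (fun w _ same other =>
        fill need k tl (Nat.land R same) (Nat.land N other) (push acc w)) R col) true) true = true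
        at h
      rw [guard_check_row hRs r fun d hd => hR d (hsuf d hd)] at h
      have hneed' : meets N need = true := by
        rcases hneed with rfl | ⟨rfl, hne⟩
        · exact meets_zero N
        · obtain ⟨f, hf⟩ := List.exists_mem_of_ne_nil _ hne
          exact guard_check_row (c := 0) hNs f fun d _ => hN f hf d
      rw [hneed'] at h
      rw [List.nodup_cons] at hl
      refine ih hl.2 htl (hRs.land _) (hNs.land _) (fun d hd => ?_) (fun f hf d => ?_)
        (forColumn_spec (hR c List.mem_cons_self) (hmem r hrF) h)
      · rw [testBit_land, hR d (List.mem_cons_of_mem _ hd), Bool.true_and]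
        exact Row.testBit_same hr (by rintro rfl; exact hl.1 hd)
      · rw [testBit_land, hN f hf d, Bool.true_and]
        exact (hF' f hf).testBit_other c d

theorem testBit_lor_offFirst {r f : Row} (h : f 0 0 < r 0 0) (c : Fin 6) :
    (Nat.lor offFirst (Nat.sub (Nat.pow 2 (r.word 0)) 1)).testBit (f.word c) = true := by
  rw [testBit_lor, Bool.or_eq_true]
  by_cases hc : c = 0
  · subst hc
    right
    have : f.word 0 < r.word 0 := by
      simp only [Row.word, code_eq]
      omega
    exact (Nat.testBit_two_pow_sub_one _ _).trans (decide_eq_true this)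
  · left
    have h : ∀ c : Fin 6, c ≠ 0 → ∀ a b g : Fin 6, offFirst.testBit (code c a b g) = true := by
      decide +kernel
    exact h c hc _ _ _

theorem fillRow_spec {need : ℕ} {k : ℕ → ℕ → Bool} {F F' : List Row} {r : Row} (hrF : r ∈ F)
    (hr : ∀ s, Function.Injective (r s)) (hF' : ∀ f ∈ F', r.Compatible f)
    (hlt : ∀ f ∈ F', f 0 0 < r 0 0) (hneed : need = 0 ∨ need = guard 0 ∧ F' ≠ []) {cs : Columns}
    (hcs : cs.Covers F [0, 1, 2, 3, 4, 5]) {N acc : ℕ} (hNs : Small N)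
    (hR : ∀ c, N.testBit (r.word c) = true) (hN : ∀ f ∈ F', ∀ c, N.testBit (f.word c) = true)
    (h : fillRow need k cs N acc = true) :
    ∃ N', Small N' ∧ (∀ f ∈ F', ∀ c, N'.testBit (f.word c) = true) ∧
      k N' (([0, 1, 2, 3, 4, 5].map r.word).foldl push acc) = true := by
  cases cs with
  | nil => exact hcs.elim
  | cons col rest tl =>
    obtain ⟨-, -, hmem, htl⟩ := hcs
    refine fill_spec (l := [1, 2, 3, 4, 5]) hrF hr hF' hneed (by decide) htl (hNs.land _)
      ((hNs.land _).land _) (fun d hd => ?_) (fun f hf d => ?_)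
      (forColumn_spec (hR 0) (hmem r hrF) h)
    · rw [testBit_land, hR d, Bool.true_and]
      exact Row.testBit_same hr (by rintro rfl; revert hd; decide)
    · rw [testBit_land, testBit_land, hN f hf d, Bool.true_and, Bool.and_eq_true]
      exact ⟨(hF' f hf).testBit_other 0 d, testBit_lor_offFirst (hlt f hf) d⟩

theorem fillRows_spec {leaf : ℕ → Bool} {F F' : List Row} (hsub : F' ⊆ F)
    (hF : ∀ r ∈ F', ∀ s, Function.Injective (r s))
    (hF' : F'.Pairwise fun r f => r.Compatible f ∧ f 0 0 < r 0 0) {cs : Columns}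
    (hcs : cs.Covers F [0, 1, 2, 3, 4, 5]) {N acc : ℕ} (hNs : Small N)
    (hN : ∀ f ∈ F', ∀ c, N.testBit (f.word c) = true)
    (h : fillRows leaf cs F'.length N acc = true) :
    leaf (F'.foldl (fun acc r => ([0, 1, 2, 3, 4, 5].map r.word).foldl push acc) acc) = true := by
  induction F' generalizing N acc with
  | nil => exact h
  | cons r F' ih =>
    rw [List.pairwise_cons] at hF'
    have hneed : ∀ x : ℕ, x = Nat.rec 0 (fun _ _ => guard 0) F'.length →
        x = 0 ∨ x = guard 0 ∧ F' ≠ [] := by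
      rintro x rfl
      cases F' with
      | nil => exact Or.inl rfl
      | cons => exact Or.inr ⟨rfl, List.cons_ne_nil _ _⟩
    obtain ⟨N', hNs', hN', hk⟩ := fillRow_spec (hsub List.mem_cons_self) (hF r List.mem_cons_self)
      (fun f hf => (hF'.1 f hf).1) (fun f hf => (hF'.1 f hf).2) (hneed _ rfl) hcs hNs
      (hN r List.mem_cons_self) (fun f hf => hN f (List.mem_cons_of_mem _ hf)) h
    exact ih (fun f hf => hsub (List.mem_cons_of_mem _ hf))
      (fun f hf => hF f (List.mem_cons_of_mem _ hf)) hF'.2 hNs' hN' hk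

theorem iter_forall {n : ℕ} {p : ℕ → Bool → Bool} (h : iter n true p = true) {P : ℕ → Prop}
    (hp : ∀ i x, p i x = true → x = true ∧ P i) {i : ℕ} (hi : i < n) : P i := by
  induction n with
  | zero => omega
  | succ n ih =>
    have := hp n _ h
    rcases Nat.lt_succ_iff_lt_or_eq.mp hi with h' | rfl
    · exact ih this.1 h'
    · exact this.2

theorem fillSecond_spec {k : ℕ → ℕ → Bool} {F : List Row} {r : Row}
    (hr : ∀ s, Function.Injective (r s)) (hF : ∀ f ∈ F, r.Compatible f) {l : List (Fin 6)}
    (hl : l.Nodup) {R N acc : ℕ} (hNs : Small N) (hR : ∀ c ∈ l, R.testBit (r.word c) = true)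
    (hN : ∀ f ∈ F, ∀ c, N.testBit (f.word c) = true)
    (h : fillSecond k (l.map fun c => (c.val, (r 0 c).val, (r 1 c).val)) R N acc = true) :
    ∃ N', Small N' ∧ (∀ f ∈ F, ∀ c, N'.testBit (f.word c) = true) ∧
      k N' ((l.map r.word).foldl push acc) = true := by
  induction l generalizing R N acc with
  | nil => exact ⟨N, hNs, hN, h⟩
  | cons c l ih =>
    rw [List.nodup_cons] at hl
    have key : fillSecond k (l.map fun c => (c.val, (r 0 c).val, (r 1 c).val))
        (Nat.land R (r.same c)) (Nat.land N (r.other c)) (push acc (r.word c)) = true := by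
      obtain ⟨K, hK⟩ : ∃ K : ℕ → Bool, K = fun g =>
          fillSecond k (l.map fun c => (c.val, (r 0 c).val, (r 1 c).val))
            (Nat.land R (sameRow c (r 0 c) (r 1 c) g)) (Nat.land N (otherRow c (r 0 c) (r 1 c) g))
            (push acc (code c (r 0 c) (r 1 c) g)) := ⟨_, rfl⟩
      have h' : iter 6 true (fun g x => sel (Nat.beq (Nat.land R
          (Nat.pow 2 (code c (r 0 c) (r 1 c) g))) 0) x (sel (K g) x false)) = true := by
        rw [hK]; exact h
      have := iter_forall (P := fun g => R.testBit (code c (r 0 c) (r 1 c) g) = true → K g = true)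
        h' (fun g x hx => ⟨sel_sel hx, fun hb => by
          rw [beq_land_two_pow hb] at hx; exact (sel_false.mp hx).1⟩) (r 2 c).isLt
        (hR c List.mem_cons_self)
      rw [hK] at this
      exact this
    refine ih hl.2 (hNs.land _) (fun d hd => ?_) (fun f hf d => ?_) key
    · rw [testBit_land, hR d (List.mem_cons_of_mem _ hd), Bool.true_and]
      exact Row.testBit_same hr (by rintro rfl; exact hl.1 hd)
    · rw [testBit_land, hN f hf d, Bool.true_and]
      exact (hF f hf).testBit_other c d

theorem testBit_afterFirst {r : Row} (h : Row.Compatible (fun _ => id) r) (c : Fin 6) :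
    afterFirst.testBit (r.word c) = true := by
  have h0 := h.testBit_other
  have hf := testBit_full_code c (r 0 c) (r 1 c) (r 2 c)
  change (Nat.land (Nat.land (Nat.land (Nat.land (Nat.land (Nat.land full _) _) _) _) _) _).testBit
    _ = true
  simp only [testBit_land, Bool.and_eq_true]
  exact ⟨⟨⟨⟨⟨⟨hf, h0 0 c⟩, h0 1 c⟩, h0 2 c⟩, h0 3 c⟩, h0 4 c⟩, h0 5 c⟩

theorem small_afterFirst : Small afterFirst :=
  ((((((small_full.land _).land _).land _).land _).land _).land _)

theorem search_spec {leaf : ℕ → Bool} {r : Fin 5 → Row} (h0 : r 0 = fun _ => id)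
    (hr : ∀ i s, Function.Injective (r i s)) (hc : ∀ i j, i ≠ j → (r i).Compatible (r j))
    (h32 : r 3 0 0 < r 2 0 0) (h43 : r 4 0 0 < r 3 0 0)
    (h : search leaf ([0, 1, 2, 3, 4, 5].map fun c => (c.val, (r 1 0 c).val, (r 1 1 c).val)) =
      true) :
    leaf (([r 0, r 1, r 2, r 3, r 4].flatMap fun f => [0, 1, 2, 3, 4, 5].map f.word).foldl
      push 0) = true := by
  have hS : ∀ i, i ≠ 0 → ∀ c, afterFirst.testBit ((r i).word c) = true := fun i hi =>
    testBit_afterFirst (h0 ▸ hc 0 i hi.symm)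
  obtain ⟨N, hNs, hN, hk⟩ := fillSecond_spec (F := [r 2, r 3, r 4]) (hr 1)
    (by simpa using ⟨hc 1 2 (by decide), hc 1 3 (by decide), hc 1 4 (by decide)⟩) (by decide)
    small_afterFirst (fun c _ => hS 1 (by decide) c)
    (by simpa using ⟨hS 2 (by decide), hS 3 (by decide), hS 4 (by decide)⟩) h
  have := fillRows_spec (List.Subset.refl _) (by simpa using ⟨hr 2, hr 3, hr 4⟩)
    (by simpa using ⟨⟨⟨hc 2 3 (by decide), h32⟩, hc 2 4 (by decide), h43.trans h32⟩,
      hc 3 4 (by decide), h43⟩) (columns_covers hN) hNs hN hk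
  rw [h0]
  exact this

/-! ### The seven classes -/

noncomputable def nth (l : List ℕ) : ℕ → ℕ :=
  List.rec (fun _ => 0) (fun x _ ih n => Nat.rec x (fun m _ => ih m) n) l

/-- The rectangles of the representatives, the rows being written one after the other in decimal
digits (without the leading zero). -/
def tables : List (List ℕ) :=
  [[12345120453543021354210201534, 12345201534435210120453543102, 12345543210354102201534120453],
   [12345120453543210435021201534, 12345201534435102120453354210, 12345543102354021201534120453],
   [12345120453543102435210201534, 12345201534435021120453354210, 12345543102354210201534120453],
   [12345120453543102435210201534, 12345201534435021120453354102, 12345543102354210201534120453],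
   [12345120453543102435021201534, 12345201534435021120453354210, 12345543102354210201534120453],
   [12345120453435021354102201534, 12345201534354210120453543021, 12345543102201453435021354210],
   [12345120453534201345012201534, 12345201534453120120453534201, 12345534201345012201534120453]]

noncomputable def table (a s : ℕ) : ℕ :=
  nth (List.rec (fun _ => []) (fun x _ ih n => Nat.rec x (fun m _ => ih m) n) tables a) s

noncomputable def tableEntry (a s i j : ℕ) : ℕ :=
  Nat.mod (Nat.div (table a s) (Nat.pow 10 (Nat.sub 29 (Nat.add (Nat.mul 6 i) j)))) 10

theorem tableEntry_lt : ∀ (a : Fin 7) (s : Fin 3) (i : Fin 5) (j : Fin 6), tableEntry a s i j < 6 := by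
  decide +kernel

/-- The representatives of the isotopism classes. -/
noncomputable def representative (a : Fin 7) (s : Fin 3) (i : Fin 5) (j : Fin 6) : Fin 6 :=
  ⟨tableEntry a s i j, tableEntry_lt a s i j⟩

/-! ### Certificates for the results of the search -/

/-- The symbols in a sequence of words as accumulated by `search`. -/
noncomputable def entry (X s i j : ℕ) : ℕ :=
  Nat.mod (Nat.div (Nat.mod (Nat.mod (Nat.div X
    (Nat.pow 2048 (Nat.sub 29 (Nat.add (Nat.mul 6 i) j)))) 2048) 256) (Nat.pow 6 (Nat.sub 2 s))) 6

noncomputable def digit (cert k : ℕ) : ℕ := Nat.mod (Nat.div cert (Nat.pow 10 k)) 10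

noncomputable def forallLt (n : ℕ) (p : ℕ → Bool) : Bool :=
  iter n true fun k x => sel (p k) x false

noncomputable def isPerm (n : ℕ) (f : ℕ → ℕ) : Bool :=
  forallLt n fun i => sel (Nat.ble (Nat.succ (f i)) n)
    (forallLt n fun j => sel (Nat.beq (f i) (f j)) (Nat.beq i j) true) false

/-- Checks that the given maps of rectangles, rows and columns give an isotopism with the `a`-th
representative. -/
noncomputable def isIsotopism (X a : ℕ) (ρ σr σc : ℕ → ℕ) : Bool :=
  sel (Nat.ble a 6) (sel (isPerm 3 ρ) (sel (isPerm 5 σr) (sel (isPerm 6 σc)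
    (forallLt 3 fun s => forallLt 5 fun i => forallLt 6 fun j =>
      Nat.beq (entry X (ρ s) (σr 0) (σc (tableEntry a s i j))) (entry X (ρ s) (σr i) (σc j)))
    false) false) false) false

/-- Each certificate consists, in decimal digits, of a key, the number of a representative, and
permutations of rectangles, rows and columns. -/
def certificates : List ℕ :=
  [1220104312012534, 2201210324021543, 19310201342354021, 38210210342345201, 46012012340021354,
   99312002341345120, 138220114302354210, 166501201234012345, 212312013240021435,
   226620114203021435, 253220114203354102, 261012013240021435, 265212003241012453,
   295002104321354102, 303301201324012453, 325321012304345012, 387321002314354210,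
   397210201342021543, 399601201324012453, 416302114230012453, 422210210243012534,
   425401210324354021, 447202104321021543, 460001210234021354, 467301201324345201,
   510402114230345201, 515401201234012534, 542202114320345120, 551621002314021354,
   593312003241012453, 596002114320345201, 601002104231354210, 603320104312345012,
   616401210324354102, 620621013204012453, 645202114230012534, 648621012304012534,
   654220114302354021, 672402114230012453, 687601201324012534, 703610201243021543,
   727201201234012345, 757621013204012345, 829302114320345120, 834220114302021435,
   843220104213012345, 845320104312012534, 846401210324021543, 851320104213345201,
   861220104213345120, 917302104231021435, 923101201234012534, 941501210324021435,
   969402114230012534, 987202104321354102, 997401210324021435, 1015221002314021354,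
   1051401201234012345, 1057620104312012345, 1069001210234354102, 1125401201234345012,
   1156101210234354210, 1167501210234021543, 1177620114302021354, 1202002114230012534,
   1205301201324345012, 1206210210342012453, 1218321012304012534, 1241220114302021354,
   1245202104231021435, 1259210201243354210, 1262401210234021354, 1266001210324354210,
   1274002114320012453, 1279621002314021435, 1321402114230345012, 1323612002341012345,
   1355221002314354210, 1389401201324012453, 1390612013240021435, 1407001201324345012,
   1413610210342012453, 1420610210342012534, 1432610210243012345, 1452302114230345012,
   1457012003241012453, 1479012003241012534, 1483620104213012453, 1491210201342354021,
   1495310201243021354, 1510310210342345201, 1512212013240021435, 1518320114203021543,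
   1527001201324012453, 1553301210324021435, 1567612003241012534, 1571501210324021354,
   1575402104231354021, 1587602104231021354, 1606101210234021354, 1613012002341345012,
   1631602104231021435, 1637210210243345120, 1655610201243021354, 1691201201234345120,
   1722321013204012345, 1727012002341012345, 1768501201234345201, 1777101201234345012,
   1785321002314021435, 1787320104213012453, 1797501201324345012, 1801101210324021435,
   1805501201234012453, 1813002104321021543, 1817612012340021543, 1832101210324354102,
   1853202104231354210, 1866602114320012345, 1876001210234021543, 1892201210234354102,
   1900212012340354210, 1920501201324345120, 1932301210324021543, 1936212013240354021,
   1938312012340354210, 1943101201324345201, 1953012012340354021, 1957402104321354210,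
   1958310210342345012, 1970001210324354021, 1972221013204012345, 1987202104321021354,
   2007301201234345120, 2050310210342012453, 2062501201324012534, 2067001201234345201,
   2075402104321021543, 2080012013240354210, 2091620104312012534, 2099321003214354102,
   2103002104231021435, 2111220104213012453, 2117302104231354210, 2121320114203354102,
   2129321013204012453, 2197612003241012453, 2208601210234021354, 2218101210324021543,
   2221221002314354021, 2225320104312345120, 2233201201324012453, 2236321013204345120,
   2252401210234354210, 2335001201234012345, 2337001210324021435, 2349301210324354021,
   2367002104231021354, 2391401201324345201, 2405101201324012453, 2415221003214354102,
   2423012003241345120, 2435312002341012345, 2457601201234012345, 2459402104321354102,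
   2489201201324345012, 2573602114320012453, 2631310201342021435, 2690012012340021543,
   2719220104213345201, 2731101201234012345, 2764312012340021354, 2776212012340021354,
   2783002104321354021, 2809001201234345120, 2818201210234021354, 2825310210243012345,
   2831402104321021354, 2837602104321021543, 2907301201234012345, 3009002114320012345,
   3030320114302354210, 3035312003241345012, 3068301210234021354, 3073301201234012534,
   3102620114203021543, 3127310201243354210, 3136402114320012345, 3137310201243354102,
   3148221012304012534, 3149210210243012345, 3170602114230012534, 3176301210234354102,
   3181212012340021543, 3199321002314021354, 3204302114320345201, 3230310210243012534,
   3231212003241012534, 3233621003214021543, 3241210201342354102, 3242202114320345201,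
   3246320114203354021, 3279501210324354210, 3317201210324354021, 3320221013204345201,
   3323201201234012534, 3359212002341345120, 3375302104321021354, 3401501210234354021,
   3425312012340021543, 3434402114320345120, 3443202104231354021, 3445101210234354021,
   3480202114230012453, 3495220104312345012, 3496002114230345012, 3505321002314354021,
   3520221013204345120, 3534312012340354102, 3559401201234345120, 3590210210243345012,
   3636321013204345201, 3651320104213012345, 3673610201342021435, 3721221012304345012,
   3725221003214021543, 3733201210324021435, 3746612012340021354, 3751302104321021543,
   3801601210234021543, 3804301210234354210, 3817202114230345012, 3821212012340354102,
   3823212002341012345, 3863201201324345201, 3875212003241345012, 3896601210324021435,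
   3907012002341345201, 3917310201342021543, 3941312003241345201, 3967501210234354102,
   3975321003214021543, 3977320114302021354, 3979101201324345120, 3980202114320012345,
   3989302114230012534, 3992302114320012345, 4053402104231021435, 4116012013240354102,
   4120201210234354210, 4133310210243345120, 4181001201324012534, 4205212003241345201,
   4219221002314021435, 4247302104321354102, 4259210201342021435, 4283302104231354021,
   4291312003241012534, 4301312013240354021, 4303210201243021354, 4305002114230345120,
   4313221013204012453, 4326220114203021543, 4354320114302021435]

noncomputable def isRepresented (X : ℕ) : Bool :=
  List.rec false (fun cert _ ih =>
    sel (Nat.beq (Nat.div cert (Nat.pow 10 15)) (Nat.mod X 4364))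
      (isIsotopism X (digit cert 14) (fun s => digit cert (Nat.sub 13 s))
        (fun i => digit cert (Nat.sub 10 i)) (fun j => digit cert (Nat.sub 5 j))) ih) certificates

set_option maxRecDepth 100000 in
theorem search_123054_204513 :
    search isRepresented [(0, 1, 2), (1, 2, 0), (2, 3, 4), (3, 0, 5), (4, 5, 1), (5, 4, 3)] =
      true := by
  decide +kernel

set_option maxRecDepth 100000 in
theorem search_123054_234501 :
    search isRepresented [(0, 1, 2), (1, 2, 3), (2, 3, 4), (3, 0, 5), (4, 5, 0), (5, 4, 1)] =
      true := by
  decide +kernel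

set_option maxRecDepth 100000 in
theorem search_123054_240531 :
    search isRepresented [(0, 1, 2), (1, 2, 4), (2, 3, 0), (3, 0, 5), (4, 5, 3), (5, 4, 1)] =
      true := by
  decide +kernel

set_option maxRecDepth 100000 in
theorem search_123054_241503 :
    search isRepresented [(0, 1, 2), (1, 2, 4), (2, 3, 1), (3, 0, 5), (4, 5, 0), (5, 4, 3)] =
      true := by
  decide +kernel

set_option maxRecDepth 100000 in
theorem search_123054_304521 :
    search isRepresented [(0, 1, 3), (1, 2, 0), (2, 3, 4), (3, 0, 5), (4, 5, 2), (5, 4, 1)] =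
      true := by
  decide +kernel

set_option maxRecDepth 100000 in
theorem search_123054_341520 :
    search isRepresented [(0, 1, 3), (1, 2, 4), (2, 3, 1), (3, 0, 5), (4, 5, 2), (5, 4, 0)] =
      true := by
  decide +kernel

set_option maxRecDepth 100000 in
theorem search_120453_201534 :
    search isRepresented [(0, 1, 2), (1, 2, 0), (2, 0, 1), (3, 4, 5), (4, 5, 3), (5, 3, 4)] =
      true := by
  decide +kernel

set_option maxRecDepth 100000 in
theorem search_120453_234501 :
    search isRepresented [(0, 1, 2), (1, 2, 3), (2, 0, 4), (3, 4, 5), (4, 5, 0), (5, 3, 1)] =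
      true := by
  decide +kernel

theorem forallLt_spec {n : ℕ} {p : ℕ → Bool} (h : forallLt n p = true) {i : ℕ} (hi : i < n) :
    p i = true :=
  iter_forall (P := fun i => p i = true) h (fun _ _ h => (sel_false.mp h).symm) hi

theorem isPerm_spec {n : ℕ} {f : ℕ → ℕ} (h : isPerm n f = true) :
    ∃ σ : Perm (Fin n), ∀ i : Fin n, (σ i : ℕ) = f i := by
  have hlt : ∀ i : Fin n, f i < n := fun i =>
    Nat.le_of_ble_eq_true (sel_false.mp (forallLt_spec h i.isLt)).1
  have hinj : Function.Injective fun i : Fin n => (⟨f i, hlt i⟩ : Fin n) := by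
    intro i j hij
    have := forallLt_spec (sel_false.mp (forallLt_spec h i.isLt)).2 j.isLt
    rw [show Nat.beq (f i) (f j) = true from Nat.beq_eq.mpr (Fin.ext_iff.mp hij)] at this
    exact Fin.ext (Nat.beq_eq.mp this)
  exact ⟨Equiv.ofBijective _ (Finite.injective_iff_bijective.mp hinj), fun i => rfl⟩

theorem isotopic_of_isIsotopism {X a : ℕ} {ρ σr σc : ℕ → ℕ} (h : isIsotopism X a ρ σr σc = true)
    {M : Fin 3 → Fin 5 → Fin 6 → Fin 6} (hM : ∀ s i, Function.Injective (M s i))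
    (hX : ∀ s i j, entry X s.val i.val j.val = (M s i j).val) :
    ∃ a, Isotopic M (representative a) := by
  obtain ⟨ha, h⟩ := sel_false.mp h
  obtain ⟨hρ, h⟩ := sel_false.mp h
  obtain ⟨hr, h⟩ := sel_false.mp h
  obtain ⟨hc, h⟩ := sel_false.mp h
  obtain ⟨ρ', hρ'⟩ := isPerm_spec hρ
  obtain ⟨σr', hr'⟩ := isPerm_spec hr
  obtain ⟨σc', hc'⟩ := isPerm_spec hc
  have ha' : a < 7 := Nat.lt_succ_of_le (Nat.le_of_ble_eq_true ha)
  let g : Fin 3 → Perm (Fin 6) := fun s => σc'.trans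
    (Equiv.ofBijective (M (ρ' s) (σr' 0)) (Finite.injective_iff_bijective.mp (hM _ _)))
  refine ⟨⟨a, ha'⟩, ρ', σr', σc', fun s => (g s).symm, fun s i j => ?_⟩
  rw [Equiv.eq_symm_apply]
  have := Nat.beq_eq.mp (forallLt_spec (forallLt_spec (forallLt_spec h s.isLt) i.isLt) j.isLt)
  rw [← hρ', ← hr', ← hc', show σr 0 = σr' 0 from (hr' 0).symm,
    show tableEntry a s i j = (representative ⟨a, ha'⟩ s i j).val from rfl, ← hc', hX, hX] at this
  exact Fin.ext this

theorem isIsotopism_of_isRepresented {X : ℕ} (h : isRepresented X = true) :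
    ∃ a ρ σr σc, isIsotopism X a ρ σr σc = true := by
  rw [isRepresented] at h
  revert h
  generalize certificates = l
  intro h
  induction l with
  | nil => cases h
  | cons cert l ih =>
    change sel (Nat.beq (Nat.div cert (Nat.pow 10 15)) (Nat.mod X 4364))
      (isIsotopism X (digit cert 14) (fun s => digit cert (Nat.sub 13 s))
        (fun i => digit cert (Nat.sub 10 i)) (fun j => digit cert (Nat.sub 5 j))) _ = true at h
    revert h
    cases Nat.beq (Nat.div cert (Nat.pow 10 15)) (Nat.mod X 4364)
    · exact ih
    · exact fun h => ⟨_, _, _, _, h⟩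

theorem foldl_push_div {l : List ℕ} (hl : ∀ x ∈ l, x < 2048) {k : ℕ} (hk : k < l.length) (acc : ℕ) :
    l.foldl push acc / 2048 ^ (l.length - 1 - k) % 2048 = l[k] := by
  induction l using List.reverseRecOn generalizing k with
  | nil => simp at hk
  | append_singleton l x ih =>
    have hx := hl x (by simp)
    have hpush : (l ++ [x]).foldl push acc = 2048 * l.foldl push acc + x := by
      rw [List.foldl_append]; rfl
    rw [hpush]
    simp only [List.length_append, List.length_singleton] at hk ⊢
    rcases Nat.lt_succ_iff_lt_or_eq.mp hk with h | rfl
    · rw [List.getElem_append_left h, ← ih (fun y hy => hl y (by simp [hy])) h,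
        show l.length + 1 - 1 - k = l.length - 1 - k + 1 by omega, pow_succ',
        ← Nat.div_div_eq_div_mul]
      congr 2
      omega
    · rw [List.getElem_append_right (le_refl _)]
      simp
      omega

theorem Row.word_lt (r : Row) (c : Fin 6) : r.word c < 2048 := by
  rw [word, code_eq]
  omega

theorem entry_foldl_push (r : Fin 5 → Row) (s : Fin 3) (i : Fin 5) (j : Fin 6) :
    entry (([r 0, r 1, r 2, r 3, r 4].flatMap fun f => [0, 1, 2, 3, 4, 5].map f.word).foldl push 0)
      s i j = r i s j := by
  obtain ⟨l, hl⟩ : ∃ l, l = [r 0, r 1, r 2, r 3, r 4].flatMap fun f =>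
    [0, 1, 2, 3, 4, 5].map f.word := ⟨_, rfl⟩
  have hlen : l.length = 30 := by rw [hl]; rfl
  have hk : 6 * i.val + j.val < l.length := by omega
  have hget : l[6 * i.val + j.val] = (r i).word j := by
    subst hl
    fin_cases i <;> fin_cases j <;> rfl
  have hlt : ∀ x ∈ l, x < 2048 := by
    intro x hx
    simp only [hl, List.mem_flatMap, List.mem_map] at hx
    obtain ⟨f, -, c, -, rfl⟩ := hx
    exact f.word_lt c
  have := foldl_push_div hlt hk 0
  rw [hlen, hget] at this
  rw [← hl]
  change (l.foldl push 0 / 2048 ^ (29 - (6 * i.val + j.val)) % 2048 % 256) / 6 ^ (2 - s.val) % 6 = _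
  rw [show 29 - (6 * i.val + j.val) = 30 - 1 - (6 * i.val + j.val) from rfl, this, Row.word, code_eq,
    add_assoc, Nat.mul_add_mod, Nat.mod_eq_of_lt (by omega : 36 * (r i 0 j).val + _ < 256)]
  have h : ∀ a b g : Fin 6, (36 * a.val + (6 * b.val + g.val)) / 36 % 6 = a.val ∧
      (36 * a.val + (6 * b.val + g.val)) / 6 % 6 = b.val ∧
      (36 * a.val + (6 * b.val + g.val)) / 1 % 6 = g.val := by
    decide +kernel
  obtain ⟨h₀, h₁, h₂⟩ := h (r i 0 j) (r i 1 j) (r i 2 j)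
  fin_cases s
  exacts [h₀, h₁, h₂]

/-! ### The representatives are orthogonal and pairwise non-isotopic -/

noncomputable def indicator (x y : ℕ) : ℕ := sel (Nat.beq x y) 1 0

theorem indicator_eq (x y : ℕ) : indicator x y = if x = y then 1 else 0 := by
  unfold indicator
  split_ifs with h
  · rw [Nat.beq_eq.mpr h]; rfl
  · rw [Bool.eq_false_iff.mpr (mt Nat.beq_eq.mp h)]; rfl

/-- Any two distinct cells of the `a`-th representative agree in at most one of the row, the
column, and the three symbols. -/
noncomputable def isOrthogonal (a : ℕ) : Bool :=
  forallLt 5 fun i => forallLt 6 fun j => forallLt 5 fun k => forallLt 6 fun l =>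
    sel (sel (Nat.beq i k) (Nat.beq j l) false) true
      (Nat.ble (Nat.add (indicator i k) (Nat.add (indicator j l)
        (Nat.add (indicator (tableEntry a 0 i j) (tableEntry a 0 k l))
          (Nat.add (indicator (tableEntry a 1 i j) (tableEntry a 1 k l))
            (indicator (tableEntry a 2 i j) (tableEntry a 2 k l)))))) 1)

theorem isOrthogonal_all : forallLt 7 isOrthogonal = true := by
  decide +kernel

theorem representative_agree {a : Fin 7} {i k : Fin 5} {j l : Fin 6} (h : ¬(i = k ∧ j = l)) :
    (if i = k then 1 else 0) + ((if j = l then 1 else 0) +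
      ((if representative a 0 i j = representative a 0 k l then 1 else 0) +
        ((if representative a 1 i j = representative a 1 k l then 1 else 0) +
          if representative a 2 i j = representative a 2 k l then 1 else 0))) ≤ 1 := by
  have := forallLt_spec (forallLt_spec (forallLt_spec (forallLt_spec
    (forallLt_spec isOrthogonal_all a.isLt) i.isLt) j.isLt) k.isLt) l.isLt
  have hf : sel (Nat.beq i k) (Nat.beq j l) false = false := by
    rw [Bool.eq_false_iff, Ne, sel_false, Nat.beq_eq, Nat.beq_eq, ← Fin.ext_iff, ← Fin.ext_iff]
    exact h
  rw [hf] at this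
  simp only [indicator_eq] at this
  simp only [Fin.ext_iff]
  exact Nat.le_of_ble_eq_true this

theorem isMOLRTriple_representative (a : Fin 7) : IsMOLRTriple (representative a) := by
  refine ⟨fun s => ⟨fun i j l h => ?_, fun j i k h => ?_⟩, fun s t hst p q h => ?_⟩
  · by_contra hjl
    have := representative_agree (a := a) (i := i) (k := i) (j := j) (l := l) (by tauto)
    fin_cases s <;> simp_all
  · by_contra hik
    have := representative_agree (a := a) (i := i) (k := k) (j := j) (l := j) (by tauto)
    fin_cases s <;> simp_all
  · obtain ⟨i, j⟩ := p
    obtain ⟨k, l⟩ := q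
    by_contra hpq
    have := representative_agree (a := a) (i := i) (k := k) (j := j) (l := l)
      (by rintro ⟨rfl, rfl⟩; exact hpq rfl)
    simp only [Prod.mk.injEq] at h
    fin_cases s <;> fin_cases t <;> simp_all <;> omega

/-- The number of equalities `M s i j = M s k l`, weighted by coincidences involving the symbols
in the cells `(i, l)` and `(k, j)`. -/
def invariant (M : Fin 3 → Fin 5 → Fin 6 → Fin 6) : ℕ :=
  ∑ s, ∑ i, ∑ k, ∑ j, ∑ l, if M s i j = M s k l then
    (∑ t, if M t k j = M t i l then 1 else 0) + ∑ h, if M s i l = M s h j then 1 else 0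
  else 0

theorem invariant_eq_of_isotopic {M M' : Fin 3 → Fin 5 → Fin 6 → Fin 6} (h : Isotopic M M') :
    invariant M' = invariant M := by
  obtain ⟨ρ, σr, σc, f, h⟩ := h
  refine Fintype.sum_equiv ρ _ _ fun s => Fintype.sum_equiv σr _ _ fun i =>
    Fintype.sum_equiv σr _ _ fun k => Fintype.sum_equiv σc _ _ fun j =>
    Fintype.sum_equiv σc _ _ fun l => ?_
  simp only [h, (f _).injective.eq_iff]
  congr 2
  · exact Fintype.sum_equiv ρ _ _ fun t => rfl
  · exact Fintype.sum_equiv σr _ _ fun t => rfl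

noncomputable def sumLt (n : ℕ) (f : ℕ → ℕ) : ℕ := iter n 0 fun k x => Nat.add x (f k)

theorem sum_eq_sumLt {n : ℕ} {f : Fin n → ℕ} {g : ℕ → ℕ} (h : ∀ i : Fin n, f i = g i) :
    ∑ i, f i = sumLt n g := by
  rw [Finset.sum_congr rfl fun i _ => h i, Fin.sum_univ_eq_sum_range]
  induction n with
  | zero => rfl
  | succ n ih =>
    rw [Finset.sum_range_succ, ih (f := fun i => g i) fun _ => rfl]
    rfl

noncomputable def tableInvariant (a : ℕ) : ℕ :=
  sumLt 3 fun s => sumLt 5 fun i => sumLt 5 fun k => sumLt 6 fun j => sumLt 6 fun l =>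
    sel (Nat.beq (tableEntry a s i j) (tableEntry a s k l))
      (Nat.add (sumLt 3 fun t => indicator (tableEntry a t k j) (tableEntry a t i l))
        (sumLt 5 fun h => indicator (tableEntry a s i l) (tableEntry a s h j))) 0

theorem invariant_representative (a : Fin 7) :
    invariant (representative a) = tableInvariant a := by
  refine sum_eq_sumLt fun s => sum_eq_sumLt fun i => sum_eq_sumLt fun k => sum_eq_sumLt fun j =>
    sum_eq_sumLt fun l => ?_
  rw [← sum_eq_sumLt (n := 3) (f := fun t => if representative a t k j = representative a t i l
      then 1 else 0) fun t => by rw [indicator_eq]; simp only [Fin.ext_iff]; rfl,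
    ← sum_eq_sumLt (n := 5) (f := fun h => if representative a s i l = representative a s h j
      then 1 else 0) fun t => by rw [indicator_eq]; simp only [Fin.ext_iff]; rfl]
  split_ifs with h
  · rw [show Nat.beq (tableEntry a s i j) (tableEntry a s k l) = true from
      Nat.beq_eq.mpr (Fin.ext_iff.mp h)]
    rfl
  · rw [show Nat.beq (tableEntry a s i j) (tableEntry a s k l) = false from
      Bool.eq_false_iff.mpr fun h' => h (Fin.ext (Nat.beq_eq.mp h'))]
    rfl

theorem tableInvariant_eq :
    [tableInvariant 0, tableInvariant 1, tableInvariant 2, tableInvariant 3, tableInvariant 4,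
      tableInvariant 5, tableInvariant 6] = [870, 882, 840, 858, 846, 900, 864] := by
  decide +kernel

theorem not_isotopic_representative {a b : Fin 7} (hab : a ≠ b) :
    ¬ Isotopic (representative a) (representative b) := by
  intro h
  have h := invariant_eq_of_isotopic h
  rw [invariant_representative, invariant_representative] at h
  have key := tableInvariant_eq
  simp only [List.cons.injEq, and_true] at key
  obtain ⟨h0, h1, h2, h3, h4, h5, h6⟩ := key
  have value : ∀ a : Fin 7, tableInvariant a = ![870, 882, 840, 858, 846, 900, 864] a := by
    intro a
    fin_cases a
    exacts [h0, h1, h2, h3, h4, h5, h6]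
  rw [value, value] at h
  exact hab ((by decide : Function.Injective ![870, 882, 840, 858, 846, 900, 864]) h).symm

/-! ### Pairs of even derangements of six symbols -/

theorem cycleType_of_derangement {σ : Perm (Fin 6)} (hσ : ∀ x, σ x ≠ x) (h : Perm.sign σ = 1) :
    (σ ^ 3 = 1 ∧ σ.cycleType = {3, 3}) ∨ (σ ^ 3 ≠ 1 ∧ σ.cycleType = {4, 2}) := by
  have hsum : σ.cycleType.sum = 6 := by
    rw [Perm.sum_cycleType, (Finset.eq_univ_iff_forall.mpr fun x => Perm.mem_support.mpr (hσ x) :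
      σ.support = Finset.univ)]
    rfl
  have htwo : ∀ x ∈ σ.cycleType, 2 ≤ x := fun x hx => Perm.two_le_of_mem_cycleType hx
  have horder : ∀ n, σ ^ n = 1 ↔ σ.cycleType.lcm ∣ n := fun n => by
    rw [Perm.lcm_cycleType, orderOf_dvd_iff_pow_eq_one]
  rw [Perm.sign_of_cycleType, hsum] at h
  rw [Ne, horder]
  generalize σ.cycleType = m at *
  have hcard : 2 * m.card ≤ 6 := by
    have := Multiset.card_nsmul_le_sum htwo
    rw [smul_eq_mul] at this
    omega
  have : m.card = 2 := by
    obtain h' | h' | h' | h' : m.card = 0 ∨ m.card = 1 ∨ m.card = 2 ∨ m.card = 3 := by omega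
    · rw [Multiset.card_eq_zero.mp h'] at hsum
      simp at hsum
    · rw [h'] at h
      exact absurd h (by decide)
    · exact h'
    · rw [h'] at h
      exact absurd h (by decide)
  obtain ⟨x, y, rfl⟩ := Multiset.card_eq_two.mp this
  have hx := htwo x (by simp)
  have hy := htwo y (by simp)
  have hxy : x + y = 6 := by simpa using hsum
  obtain ⟨rfl, rfl⟩ | ⟨rfl, rfl⟩ | ⟨rfl, rfl⟩ :
    x = 3 ∧ y = 3 ∨ x = 4 ∧ y = 2 ∨ x = 2 ∧ y = 4 := by omega
  · exact Or.inl ⟨by decide, rfl⟩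
  · exact Or.inr ⟨by decide, rfl⟩
  · exact Or.inr ⟨by decide, Multiset.pair_comm _ _⟩

/-- The representative of the even derangements of cycle type `{4, 2}`. -/
def fourTwo : Perm (Fin 6) :=
  ⟨![1, 2, 3, 0, 5, 4], ![3, 0, 1, 2, 5, 4], by decide, by decide⟩

/-- The representative of the even derangements of cycle type `{3, 3}`. -/
def threeThree : Perm (Fin 6) :=
  ⟨![1, 2, 0, 4, 5, 3], ![2, 0, 1, 5, 3, 4], by decide, by decide⟩

/-- The representatives of the pairs of discordant even derangements, up to conjugation and
exchange. -/
def starts : List ((Fin 6 → Fin 6) × (Fin 6 → Fin 6)) :=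
  [(fourTwo, ![2, 0, 4, 5, 1, 3]), (fourTwo, ![2, 3, 4, 5, 0, 1]), (fourTwo, ![2, 4, 0, 5, 3, 1]),
    (fourTwo, ![2, 4, 1, 5, 0, 3]), (fourTwo, ![3, 0, 4, 5, 2, 1]), (fourTwo, ![3, 4, 1, 5, 2, 0]),
    (threeThree, ![2, 0, 1, 5, 3, 4]), (threeThree, ![2, 3, 4, 5, 0, 1])]

/-- `π` conjugates `α` and `β` to `p.1` and `p.2`. -/
def ConjugatesTo (π α β : Fin 6 → Fin 6) (p : (Fin 6 → Fin 6) × (Fin 6 → Fin 6)) : Prop :=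
  ∀ x, π (α x) = p.1 (π x) ∧ π (β x) = p.2 (π x)

instance (π α β : Fin 6 → Fin 6) (p : (Fin 6 → Fin 6) × (Fin 6 → Fin 6)) :
    Decidable (ConjugatesTo π α β p) :=
  inferInstanceAs (Decidable (∀ _, _))

theorem forall_discordant {α : Fin 6 → Fin 6} {P : (Fin 6 → Fin 6) → Prop}
    (h : ∀ b₀, b₀ ≠ 0 → b₀ ≠ α 0 → ∀ b₁, b₁ ≠ 1 → b₁ ≠ α 1 → b₁ ≠ b₀ →
      ∀ b₂, b₂ ≠ 2 → b₂ ≠ α 2 → b₂ ≠ b₀ → b₂ ≠ b₁ →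
      ∀ b₃, b₃ ≠ 3 → b₃ ≠ α 3 → b₃ ≠ b₀ → b₃ ≠ b₁ → b₃ ≠ b₂ →
      ∀ b₄, b₄ ≠ 4 → b₄ ≠ α 4 → b₄ ≠ b₀ → b₄ ≠ b₁ → b₄ ≠ b₂ → b₄ ≠ b₃ →
      ∀ b₅, b₅ ≠ 5 → b₅ ≠ α 5 → b₅ ≠ b₀ → b₅ ≠ b₁ → b₅ ≠ b₂ → b₅ ≠ b₃ → b₅ ≠ b₄ →
        P ![b₀, b₁, b₂, b₃, b₄, b₅])
    {β : Perm (Fin 6)} (hβ : ∀ x, β x ≠ x) (hαβ : ∀ x, β x ≠ α x) : P β := by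
  have hne : ∀ {x y}, x ≠ y → β x ≠ β y := fun h => β.injective.ne h
  rw [show (β : Fin 6 → Fin 6) = ![β 0, β 1, β 2, β 3, β 4, β 5] by ext x; fin_cases x <;> rfl]
  apply h <;> first | exact hβ _ | exact hαβ _ | exact hne (by decide)

/-- A permutation in the given list conjugates `(α, β)` to an element of `starts`, up to
exchange. -/
def HasConjugator (l : List (Fin 6 → Fin 6)) (α β : Fin 6 → Fin 6) : Prop :=
  ∃ π ∈ l, Function.Injective π ∧ ∃ p ∈ starts, ConjugatesTo π α β p ∨ ConjugatesTo π β α p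

instance (l : List (Fin 6 → Fin 6)) (α β : Fin 6 → Fin 6) : Decidable (HasConjugator l α β) :=
  inferInstanceAs (Decidable (∃ _ ∈ _, _))

def IsCubeRoot (β : Fin 6 → Fin 6) : Prop := ∀ x, β (β (β x)) = x

def HasOrderFour (β : Fin 6 → Fin 6) : Prop := (∀ x, β (β (β (β x))) = x) ∧ ∃ x, β (β x) ≠ x

instance (β : Fin 6 → Fin 6) : Decidable (IsCubeRoot β) := inferInstanceAs (Decidable (∀ _, _))

instance (β : Fin 6 → Fin 6) : Decidable (HasOrderFour β) := inferInstanceAs (Decidable (_ ∧ _))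

set_option synthInstance.maxSize 1000 in
theorem hasConjugator_fourTwo {β : Perm (Fin 6)} (hβ : ∀ x, β x ≠ x) (hαβ : ∀ x, β x ≠ fourTwo x)
    (h : IsCubeRoot β ∨ HasOrderFour β) :
    HasConjugator [![0, 1, 2, 3, 4, 5], ![0, 1, 2, 3, 5, 4], ![1, 2, 3, 0, 4, 5],
      ![1, 2, 3, 0, 5, 4], ![2, 3, 0, 1, 4, 5], ![2, 3, 0, 1, 5, 4], ![3, 0, 1, 2, 4, 5],
      ![3, 0, 1, 2, 5, 4]] fourTwo β := by
  refine forall_discordant (P := fun β => IsCubeRoot β ∨ HasOrderFour β →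
    HasConjugator _ fourTwo β) ?_ hβ hαβ h
  decide +kernel

set_option synthInstance.maxSize 1000 in
theorem hasConjugator_threeThree {β : Perm (Fin 6)} (hβ : ∀ x, β x ≠ x)
    (hαβ : ∀ x, β x ≠ threeThree x) (h : IsCubeRoot β) :
    HasConjugator [![0, 1, 2, 3, 4, 5], ![0, 1, 2, 4, 5, 3], ![0, 1, 2, 5, 3, 4],
      ![0, 2, 4, 1, 3, 5], ![0, 2, 4, 3, 5, 1], ![0, 2, 4, 5, 1, 3], ![1, 2, 0, 3, 4, 5],
      ![1, 2, 0, 4, 5, 3], ![1, 2, 0, 5, 3, 4]] threeThree β := by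
  refine forall_discordant (P := fun β => IsCubeRoot β → HasConjugator _ threeThree β) ?_ hβ hαβ h
  decide +kernel

/-- The pair `(α, β)` is conjugate to an element of `starts` up to exchange. -/
def HasStart (α β : Perm (Fin 6)) : Prop :=
  ∃ π : Perm (Fin 6), ∃ p ∈ starts, ConjugatesTo π α β p ∨ ConjugatesTo π β α p

theorem HasStart.symm {α β : Perm (Fin 6)} : HasStart α β → HasStart β α := by
  rintro ⟨π, p, hp, h⟩
  exact ⟨π, p, hp, h.symm⟩

theorem hasStart_of_conj {α β γ π : Perm (Fin 6)} (hπ : π * α * π⁻¹ = γ)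
    {l : List (Fin 6 → Fin 6)} (h : HasConjugator l γ (π * β * π⁻¹ : Perm (Fin 6))) :
    HasStart α β := by
  obtain ⟨π', -, hinj, p, hp, h⟩ := h
  subst hπ
  refine ⟨π.trans (Equiv.ofBijective π' (Finite.injective_iff_bijective.mp hinj)), p, hp, ?_⟩
  refine h.imp (fun h x => ?_) (fun h x => ?_) <;> simpa using h (π x)

theorem hasStart_of_discordant {α β : Perm (Fin 6)} (hα : ∀ x, α x ≠ x) (hβ : ∀ x, β x ≠ x)
    (hαβ : ∀ x, β x ≠ α x) (hα' : Perm.sign α = 1) (hβ' : Perm.sign β = 1) : HasStart α β := by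
  have hconj : ∀ {γ π : Perm (Fin 6)}, (∀ x, γ x ≠ x) → ∀ x, (π * γ * π⁻¹) x ≠ x := by
    intro γ π hγ x hx
    exact hγ (π⁻¹ x) (by rw [Perm.eq_inv_iff_eq]; exact hx)
  have hdisc : ∀ {γ δ π : Perm (Fin 6)}, (∀ x, δ x ≠ γ x) →
      ∀ x, (π * δ * π⁻¹) x ≠ (π * γ * π⁻¹) x := fun h x hx => h _ (Equiv.injective _ hx)
  have hpow : ∀ {γ : Perm (Fin 6)} (n : ℕ) (π : Perm (Fin 6)), γ ^ n = 1 →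
      (π * γ * π⁻¹) ^ n = 1 := fun n π h => by rw [conj_pow, h]; simp
  have key : ∀ {α β : Perm (Fin 6)}, (∀ x, α x ≠ x) → (∀ x, β x ≠ x) → (∀ x, β x ≠ α x) →
      Perm.sign α = 1 → Perm.sign β = 1 → α ^ 3 ≠ 1 → HasStart α β := by
    intro α β hα hβ hαβ hα' hβ' h
    have hf := (cycleType_of_derangement (σ := fourTwo) (by decide) (by decide)).resolve_left
      fun h => absurd h.1 (by decide)
    have ht := (cycleType_of_derangement hα hα').resolve_left fun h' => h h'.1
    obtain ⟨π, hπ⟩ := isConj_iff.mp (Perm.isConj_iff_cycleType_eq.mpr (ht.2.trans hf.2.symm))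
    refine hasStart_of_conj hπ <| hasConjugator_fourTwo (hconj hβ)
      (by rw [← hπ]; exact hdisc hαβ) <| by
      rcases cycleType_of_derangement hβ hβ' with hc | hc
      · exact Or.inl fun x => Perm.ext_iff.mp (hpow 3 π hc.1) x
      · have horder : orderOf (π * β * π⁻¹) = 4 := by
          rw [← Perm.lcm_cycleType, Perm.cycleType_conj, hc.2]
          rfl
        refine Or.inr ⟨fun x => Perm.ext_iff.mp (orderOf_dvd_iff_pow_eq_one.mp
          (dvd_of_eq horder)) x, ?_⟩
        by_contra! h2
        have : (π * β * π⁻¹) ^ 2 = 1 := Perm.ext h2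
        rw [← orderOf_dvd_iff_pow_eq_one, horder] at this
        omega
  by_cases h : α ^ 3 = 1
  · by_cases h' : β ^ 3 = 1
    · have hf := (cycleType_of_derangement (σ := threeThree) (by decide) (by decide)).resolve_right
        fun h => absurd (by decide) h.1
      have ht := (cycleType_of_derangement hα hα').resolve_right fun h' => h'.1 h
      obtain ⟨π, hπ⟩ := isConj_iff.mp (Perm.isConj_iff_cycleType_eq.mpr (ht.2.trans hf.2.symm))
      exact hasStart_of_conj hπ <| hasConjugator_threeThree (hconj hβ)
        (by rw [← hπ]; exact hdisc hαβ) fun x => Perm.ext_iff.mp (hpow 3 π h') x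
    · exact (key hβ hα (fun x => (hαβ x).symm) hβ' hα' h').symm
  · exact key hα hβ hαβ hα' hβ' h

/-! ### Normalisation of a triple -/

theorem isotopic_trans {M M' M'' : Fin 3 → Fin 5 → Fin 6 → Fin 6} (h : Isotopic M M')
    (h' : Isotopic M' M'') : Isotopic M M'' := by
  obtain ⟨ρ, σr, σc, f, h⟩ := h
  obtain ⟨ρ', σr', σc', f', h'⟩ := h'
  exact ⟨ρ * ρ', σr * σr', σc * σc', fun s => f' s * f (ρ' s), fun s i j => by
    rw [h', h]; rfl⟩

theorem isMOLRTriple_of_isotopic {M M' : Fin 3 → Fin 5 → Fin 6 → Fin 6} (h : Isotopic M M')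
    (hM : IsMOLRTriple M) : IsMOLRTriple M' := by
  obtain ⟨ρ, σr, σc, f, h⟩ := h
  refine ⟨fun s => ⟨fun i j l hjl => ?_, fun j i k hik => ?_⟩, fun s t hst p q hpq => ?_⟩
  · rw [h, h] at hjl
    exact σc.injective ((hM.1 (ρ s)).1 (σr i) ((f s).injective hjl))
  · simp only [h] at hik
    exact σr.injective ((hM.1 (ρ s)).2 (σc j) ((f s).injective hik))
  · simp only [h, Prod.mk.injEq] at hpq
    have := hM.2 (ρ s) (ρ t) (ρ.injective.ne hst)
      (a₁ := (σr p.1, σc p.2)) (a₂ := (σr q.1, σc q.2))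
      (Prod.ext ((f s).injective hpq.1) ((f t).injective hpq.2))
    rw [Prod.mk.injEq] at this
    exact Prod.ext (σr.injective this.1) (σc.injective this.2)

theorem search_start : ∀ p ∈ starts, search isRepresented
    ([0, 1, 2, 3, 4, 5].map fun c => (c.val, (p.1 c).val, (p.2 c).val)) = true := by
  simp only [starts, List.forall_mem_cons]
  refine ⟨?_, ?_, ?_, ?_, ?_, ?_, ?_, ?_, fun _ h => absurd h List.not_mem_nil⟩
  exacts [(congrArg _ (by decide)).trans search_123054_204513,
    (congrArg _ (by decide)).trans search_123054_234501,
    (congrArg _ (by decide)).trans search_123054_240531,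
    (congrArg _ (by decide)).trans search_123054_241503,
    (congrArg _ (by decide)).trans search_123054_304521,
    (congrArg _ (by decide)).trans search_123054_341520,
    (congrArg _ (by decide)).trans search_120453_201534,
    (congrArg _ (by decide)).trans search_120453_234501]

theorem isotopic_representative_of_sorted {M : Fin 3 → Fin 5 → Fin 6 → Fin 6}
    (hM : IsMOLRTriple M) (h0 : ∀ s j, M s 0 j = j)
    (h1 : (M 0 1, M 1 1) ∈ starts) (h32 : M 0 3 0 < M 0 2 0) (h43 : M 0 4 0 < M 0 3 0) :
    ∃ a, Isotopic M (representative a) := by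
  have h : search isRepresented ([0, 1, 2, 3, 4, 5].map fun c : Fin 6 =>
      (c.val, (M 0 1 c).val, (M 1 1 c).val)) = true := search_start (M 0 1, M 1 1) h1
  obtain ⟨a, ρ, σr, σc, h⟩ := isIsotopism_of_isRepresented <|
    search_spec (leaf := isRepresented) (r := fun i s => M s i) (by funext s j; exact h0 s j)
      (fun i s => (hM.1 s).1 i)
      (fun i j hij => ⟨fun s c => (hM.1 s).2 c |>.ne hij, fun s t hst c c' h h' =>
        hij (congrArg Prod.fst (hM.2 s t hst (a₁ := (i, c)) (a₂ := (j, c')) (Prod.ext h h')))⟩)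
      h32 h43 h
  exact isotopic_of_isIsotopism h (fun s i => (hM.1 s).1 i)
    fun s i j => entry_foldl_push (fun i s => M s i) s i j

theorem exists_perm_sorting {x : Fin 5 → Fin 6} (hx : Function.Injective x) :
    ∃ σ : Perm (Fin 5), σ 0 = 0 ∧ σ 1 = 1 ∧ x (σ 3) < x (σ 2) ∧ x (σ 4) < x (σ 3) := by
  have h23 : x 2 ≠ x 3 := hx.ne (by decide)
  have h24 : x 2 ≠ x 4 := hx.ne (by decide)
  have h34 : x 3 ≠ x 4 := hx.ne (by decide)
  rcases h23.lt_or_gt with h | h <;> rcases h24.lt_or_gt with h' | h' <;>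
    rcases h34.lt_or_gt with h'' | h''
  · exact ⟨swap 2 4, rfl, rfl, h'', h⟩
  · exact ⟨swap 2 3 * swap 3 4, rfl, rfl, h'', h'⟩
  · exact absurd (h.trans h'') h'.asymm
  · exact ⟨swap 2 3, rfl, rfl, h, h'⟩
  · exact ⟨swap 3 4 * swap 2 3, rfl, rfl, h', h⟩
  · exact absurd (h''.trans h) h'.asymm
  · exact ⟨swap 3 4, rfl, rfl, h', h''⟩
  · exact ⟨1, rfl, rfl, h, h''⟩

theorem isotopic_representative_of_start {M : Fin 3 → Fin 5 → Fin 6 → Fin 6}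
    (hM : IsMOLRTriple M) (h0 : ∀ s j, M s 0 j = j) (h1 : (M 0 1, M 1 1) ∈ starts) :
    ∃ a, Isotopic M (representative a) := by
  obtain ⟨σ, hσ0, hσ1, h32, h43⟩ := exists_perm_sorting ((hM.1 0).2 0)
  have hiso : Isotopic M fun s i => M s (σ i) := ⟨1, σ, 1, fun _ => 1, fun _ _ _ => rfl⟩
  obtain ⟨a, ha⟩ := isotopic_representative_of_sorted (isMOLRTriple_of_isotopic hiso hM)
    (fun s j => by rw [hσ0, h0]) (by rw [hσ1]; exact h1) h32 h43
  exact ⟨a, isotopic_trans hiso ha⟩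

theorem isotopic_representative_of_even {M : Fin 3 → Fin 5 → Fin 6 → Fin 6}
    (hM : IsMOLRTriple M) (h0 : ∀ s j, M s 0 j = j) {α β : Perm (Fin 6)} (hα : M 0 1 = α)
    (hβ : M 1 1 = β) (hα' : Perm.sign α = 1) (hβ' : Perm.sign β = 1) :
    ∃ a, Isotopic M (representative a) := by
  have hne : ∀ s x, M s 1 x ≠ x := fun s x h =>
    absurd ((hM.1 s).2 x (h.trans (h0 s x).symm)) (by decide)
  obtain ⟨π, p, hp, h⟩ := hasStart_of_discordant (fun x => hα ▸ hne 0 x) (fun x => hβ ▸ hne 1 x)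
    (fun x h => by
      have := congrArg Prod.fst (hM.2 0 1 (by decide) (a₁ := (1, x)) (a₂ := (0, α x))
        (Prod.ext ((congrFun hα x).trans (h0 0 _).symm)
          ((congrFun hβ x).trans (h.trans (h0 1 _).symm))))
      exact absurd this one_ne_zero) hα' hβ'
  have hiso : ∀ ρ : Perm (Fin 3), Isotopic M fun s i j => π (M (ρ s) i (π⁻¹ j)) := fun ρ =>
    ⟨ρ, 1, π⁻¹, fun _ => π, fun _ _ _ => rfl⟩
  have key : ∀ ρ : Perm (Fin 3), ConjugatesTo π (M (ρ 0) 1) (M (ρ 1) 1) p →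
      ∃ a, Isotopic M (representative a) := by
    intro ρ h
    obtain ⟨a, ha⟩ := isotopic_representative_of_start (isMOLRTriple_of_isotopic (hiso ρ) hM)
      (fun s j => by rw [h0]; exact π.apply_symm_apply j) (by
        refine (congrArg (· ∈ starts) ?_).mpr hp
        refine Prod.ext_iff.mpr (And.intro (funext fun x => ?_) (funext fun x => ?_))
        · exact (h _).1.trans (congrArg p.1 (π.apply_symm_apply x))
        · exact (h _).2.trans (congrArg p.2 (π.apply_symm_apply x)))
    exact ⟨a, isotopic_trans (hiso ρ) ha⟩
  rw [← hα, ← hβ] at h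
  exact h.elim (key 1) (key (swap 0 1))

theorem isotopic_representative {M : Fin 3 → Fin 5 → Fin 6 → Fin 6} (hM : IsMOLRTriple M) :
    ∃ a, Isotopic M (representative a) := by
  let P (s : Fin 3) (i : Fin 5) : Perm (Fin 6) :=
    Equiv.ofBijective (M s i) (Finite.injective_iff_bijective.mp ((hM.1 s).1 i))
  obtain ⟨i, k, hik, h⟩ := Fintype.exists_ne_map_eq_of_card_lt
    (fun i => (Perm.sign (P 0 i), Perm.sign (P 1 i))) (by decide)
  rw [Prod.mk.injEq] at h
  obtain ⟨σ, rfl, rfl⟩ : ∃ σ : Perm (Fin 5), σ 0 = i ∧ σ 1 = k :=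
    ⟨swap 0 i * swap 1 (swap 0 i k), by clear h; revert i k; decide, by simp⟩
  have hiso : Isotopic M fun s i j => (P s (σ 0))⁻¹ (M s (σ i) j) :=
    ⟨1, σ, 1, fun s => (P s (σ 0))⁻¹, fun _ _ _ => rfl⟩
  obtain ⟨a, ha⟩ := isotopic_representative_of_even (isMOLRTriple_of_isotopic hiso hM)
    (fun s j => (P s (σ 0)).symm_apply_apply j) (α := (P 0 (σ 0))⁻¹ * P 0 (σ 1))
    (β := (P 1 (σ 0))⁻¹ * P 1 (σ 1)) rfl rfl
    (by rw [Perm.sign_mul, Perm.sign_inv, h.1, Int.units_mul_self])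
    (by rw [Perm.sign_mul, Perm.sign_inv, h.2, Int.units_mul_self])
  exact ⟨a, isotopic_trans hiso ha⟩

end LatinTriple

theorem stmt_10 :
    ∃ reps : Fin 7 → (Fin 3 → Fin 5 → Fin 6 → Fin 6),
      (∀ a, IsMOLRTriple (reps a)) ∧
      (∀ a b, a ≠ b → ¬ Isotopic (reps a) (reps b)) ∧
      (∀ M : Fin 3 → Fin 5 → Fin 6 → Fin 6, IsMOLRTriple M → ∃ a, Isotopic M (reps a)) :=
  ⟨LatinTriple.representative, LatinTriple.isMOLRTriple_representative,
    fun _ _ => LatinTriple.not_isotopic_representative,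
    fun _ => LatinTriple.isotopic_representative⟩
end

section
/- Up to isotopism, there is exactly one triple of mutually orthogonal 4 × 4 Latin squares; that is, triples of mutually orthogonal 4 × 4 Latin squares exist and any two such triples are isotopic. -/
/-- Three mutually orthogonal Latin squares of order 4: row permutations of the addition table of
the Klein four-group. -/
def kleinTriple (s : Fin 3) (i j : Fin 4) : Fin 4 :=
  (![![0, 1, 2, 3], ![0, 2, 3, 1], ![0, 3, 1, 2]] : Fin 3 → Fin 4 → Fin 4) s i ^^^ j

theorem isMOLRTriple_kleinTriple : IsMOLRTriple kleinTriple := by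
  unfold IsMOLRTriple IsLatinRectangle Orthogonal
  decide +kernel

/-- The `4 × 4` array with first row `0, 1, 2, 3` and the given remaining rows. -/
def arrayOfRows (p q r : Fin 4 → Fin 4) : Fin 4 → Fin 4 → Fin 4 := ![![0, 1, 2, 3], p, q, r]

theorem eq_arrayOfRows {A : Fin 4 → Fin 4 → Fin 4} (h : ∀ j, A 0 j = j) :
    A = arrayOfRows ![A 1 0, A 1 1, A 1 2, A 1 3] ![A 2 0, A 2 1, A 2 2, A 2 3]
      ![A 3 0, A 3 1, A 3 2, A 3 3] := by
  ext i j
  fin_cases i <;> fin_cases j <;> simp [arrayOfRows, h]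

/-- The four Latin squares of order 4 whose first row and column are `0, 1, 2, 3`. -/
def reducedSquares : List (Fin 4 → Fin 4 → Fin 4) :=
  [kleinTriple 0,
    arrayOfRows ![1, 0, 3, 2] ![2, 3, 1, 0] ![3, 2, 0, 1],
    arrayOfRows ![1, 2, 3, 0] ![2, 3, 0, 1] ![3, 0, 1, 2],
    arrayOfRows ![1, 3, 0, 2] ![2, 0, 3, 1] ![3, 2, 1, 0]]

set_option synthInstance.maxSize 512 in
/-- A reduced Latin square of order 4 is one of four; the hypotheses are interleaved with the
quantifiers so that the exhaustive search prunes early. -/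
theorem reduced_latin_entries :
    ∀ a b c : Fin 4, [1, a, b, c].Nodup → a ≠ 1 → b ≠ 2 → c ≠ 3 →
    ∀ d e f : Fin 4, [2, d, e, f].Nodup → [1, a, d].Nodup → [2, b, e].Nodup → [3, c, f].Nodup →
    ∀ g h k : Fin 4, [3, g, h, k].Nodup →
      [1, a, d, g].Nodup → [2, b, e, h].Nodup → [3, c, f, k].Nodup →
    arrayOfRows ![1, a, b, c] ![2, d, e, f] ![3, g, h, k] ∈ reducedSquares := by
  decide +kernel

set_option synthInstance.maxSize 512 in
/-- The only reduced Latin square of order 4 with a transversal is the Klein table; its transversals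
are given by the other two squares of `kleinTriple`. -/
theorem reduced_transversal_entries {A : Fin 4 → Fin 4 → Fin 4} (hA : A ∈ reducedSquares) :
    ∀ a b c d, [a, b, c, d].Nodup → [A 0 a, A 1 b, A 2 c, A 3 d].Nodup →
    A = kleinTriple 0 ∧
      ∃ s, s ≠ 0 ∧ a = kleinTriple s 0 a ∧ b = kleinTriple s 1 a ∧ c = kleinTriple s 2 a ∧
        d = kleinTriple s 3 a := by
  simp only [reducedSquares, List.mem_cons, List.not_mem_nil, or_false] at hA
  rcases hA with rfl | rfl | rfl | rfl <;> decide +kernel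

theorem kleinTriple_self (s : Fin 3) (i j : Fin 4) : kleinTriple s i (kleinTriple s i j) = j := by
  decide +revert +kernel

theorem kleinTriple_index_eq : ∀ s t : Fin 3, s ≠ 0 → t ≠ 0 → ∀ v w, v ≠ w →
    (∀ i, kleinTriple s i v ≠ kleinTriple t i w) → s = t := by
  decide +kernel

theorem nodup_four {α : Type*} {f : Fin 4 → α} (hf : Function.Injective f) :
    [f 0, f 1, f 2, f 3].Nodup := by
  simpa [List.ofFn_succ] using List.nodup_ofFn.2 hf

/-- If the first rows of two orthogonal rectangles are the identity, then the rectangles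
disagree in every other cell. -/
theorem Orthogonal.ne_of_ne_zero {k n : ℕ} [NeZero k] {A B : Fin k → Fin n → Fin n}
    (h : Orthogonal A B) (hA : ∀ j, A 0 j = j) (hB : ∀ j, B 0 j = j) {i : Fin k} (hi : i ≠ 0)
    (j : Fin n) : B i j ≠ A i j := by
  intro e
  have := @h (i, j) (0, A i j) (by simp [hA, hB, e])
  exact hi (congrArg Prod.fst this)

theorem reduced_latin_mem {A : Fin 4 → Fin 4 → Fin 4} (hA : IsLatinRectangle A)
    (hA0 : ∀ j, A 0 j = j) (hA' : ∀ i, A i 0 = i) :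
    A ∈ reducedSquares := by
  have row (i) := nodup_four (hA.1 i)
  have col (j) := nodup_four (hA.2 j)
  have ne (j) : A 1 j ≠ j := by
    simpa [hA0] using (hA.2 j).ne (show (1 : Fin 4) ≠ 0 by decide)
  simp only [hA0, hA'] at row col
  have drop {x y z w : Fin 4} (h : [x, y, z, w].Nodup) : [x, y, z].Nodup :=
    .sublist (List.take_sublist 3 [x, y, z, w]) h
  have eA := eq_arrayOfRows hA0
  simp only [hA'] at eA
  rw [eA]
  exact reduced_latin_entries _ _ _ (row 1) (ne 1) (ne 2) (ne 3)
    _ _ _ (row 2) (drop (col 1)) (drop (col 2)) (drop (col 3))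
    _ _ _ (row 3) (col 1) (col 2) (col 3)

/-- A reduced Latin square of order 4 that has an orthogonal mate is the Klein table, and its
mate is determined up to two choices once its first row is fixed. -/
theorem reduced_mate {A B : Fin 4 → Fin 4 → Fin 4} (hA : IsLatinRectangle A)
    (hB : IsLatinRectangle B) (hAB : Orthogonal A B) (hA0 : ∀ j, A 0 j = j)
    (hB0 : ∀ j, B 0 j = j) (hA' : ∀ i, A i 0 = i) :
    A = kleinTriple 0 ∧ (B = kleinTriple 1 ∨ B = kleinTriple 2) := by
  have transversal (v) :
      A = kleinTriple 0 ∧ ∃ s, s ≠ 0 ∧ ∀ i, B i (kleinTriple s i v) = v := by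
    choose T hT using fun i => Finite.surjective_of_injective (hB.1 i) v
    have hT0 : T 0 = v := (hB0 _).symm.trans (hT 0)
    have hinj : Function.Injective T := fun i i' h =>
      hB.2 (T i) ((hT i).trans ((hT i').symm.trans (by rw [h])))
    have hinjA : Function.Injective fun i => A i (T i) := fun i i' h =>
      congrArg Prod.fst (@hAB (i, T i) (i', T i') (Prod.ext h ((hT i).trans (hT i').symm)))
    obtain ⟨h, s, hs, h0, h1, h2, h3⟩ := reduced_transversal_entries
      (reduced_latin_mem hA hA0 hA') _ _ _ _ (nodup_four hinj) (nodup_four hinjA)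
    rw [hT0] at h0 h1 h2 h3
    refine ⟨h, s, hs, fun i => ?_⟩
    have hi : T i = kleinTriple s i v := by
      fin_cases i
      exacts [hT0.trans h0, h1, h2, h3]
    rw [← hi, hT]
  choose s hs hB' using fun v => (transversal v).2
  have hconst (v) : s v = s 0 := by
    by_cases hv : v = 0
    · rw [hv]
    · refine kleinTriple_index_eq _ _ (hs v) (hs 0) v 0 hv fun i h => hv ?_
      rw [← hB' v i, h, hB' 0 i]
  have hBs : B = kleinTriple (s 0) := by
    ext1 i
    ext1 j
    have := hB' (kleinTriple (s 0) i j) i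
    rwa [hconst, kleinTriple_self] at this
  refine ⟨(transversal 0).1, ?_⟩
  have h12 : s 0 = 1 ∨ s 0 = 2 := by have := hs 0; omega
  exact h12.imp (fun h => by rw [hBs, h]) (fun h => by rw [hBs, h])

/-- Permuting rows and symbols preserves triples of mutually orthogonal Latin rectangles. -/
theorem IsMOLRTriple.map {k n : ℕ} {M : Fin 3 → Fin k → Fin n → Fin n} (hM : IsMOLRTriple M)
    (σ : Equiv.Perm (Fin k)) (f : Fin 3 → Equiv.Perm (Fin n)) :
    IsMOLRTriple fun s i j => f s (M s (σ i) j) := by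
  refine ⟨fun s => ⟨fun i => (f s).injective.comp ((hM.1 s).1 _),
    fun j => (f s).injective.comp (((hM.1 s).2 j).comp σ.injective)⟩, fun s t hst p q hpq => ?_⟩
  simp only [Prod.mk.injEq, EmbeddingLike.apply_eq_iff_eq] at hpq
  have := @hM.2 s t hst (σ p.1, p.2) (σ q.1, q.2) (Prod.ext hpq.1 hpq.2)
  simpa [Prod.ext_iff] using this

/-- Any triple can be normalized by row and symbol permutations so that all first rows are the
identity and so is the first column of the first square. -/
theorem IsMOLRTriple.exists_reduced {n : ℕ} [NeZero n] {M : Fin 3 → Fin n → Fin n → Fin n}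
    (hM : IsMOLRTriple M) :
    ∃ (σ : Equiv.Perm (Fin n)) (f : Fin 3 → Equiv.Perm (Fin n)),
      (∀ s j, f s (M s (σ 0) j) = j) ∧ ∀ i, f 0 (M 0 (σ i) 0) = i := by
  let g (s : Fin 3) : Equiv.Perm (Fin n) :=
    Equiv.ofBijective (M s 0) (Finite.injective_iff_bijective.1 ((hM.1 s).1 0))
  have hg (s j) : (g s).symm (M s 0 j) = j := (g s).symm_apply_apply j
  let τ : Equiv.Perm (Fin n) := Equiv.ofBijective (fun i => (g 0).symm (M 0 i 0))
    (Finite.injective_iff_bijective.1 ((g 0).symm.injective.comp ((hM.1 0).2 0)))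
  have hτ : τ.symm 0 = 0 := τ.symm_apply_eq.2 (hg 0 0).symm
  refine ⟨τ.symm, fun s => (g s).symm, fun s j => ?_, fun i => τ.apply_symm_apply i⟩
  simp only [hτ, hg]

theorem stmt_11 :
    ∃ M : Fin 3 → Fin 4 → Fin 4 → Fin 4, IsMOLRTriple M ∧
      ∀ M' : Fin 3 → Fin 4 → Fin 4 → Fin 4, IsMOLRTriple M' → Isotopic M' M := by
  refine ⟨kleinTriple, isMOLRTriple_kleinTriple, fun M hM => ?_⟩
  obtain ⟨σ, f, hrow, hcol⟩ := hM.exists_reduced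
  have hN := hM.map σ f
  obtain ⟨h0, h1⟩ := reduced_mate (hN.1 0) (hN.1 1) (hN.2 0 1 (by decide)) (hrow 0) (hrow 1) hcol
  obtain ⟨-, h2⟩ := reduced_mate (hN.1 0) (hN.1 2) (hN.2 0 2 (by decide)) (hrow 0) (hrow 2) hcol
  have hne := (hN.2 1 2 (by decide)).ne_of_ne_zero (hrow 1) (hrow 2) (i := 1) (by decide) 0
  suffices ∃ ρ : Equiv.Perm (Fin 3), ∀ s,
      kleinTriple s = fun i j => f (ρ s) (M (ρ s) (σ i) j) by
    obtain ⟨ρ, hρ⟩ := this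
    exact ⟨ρ, σ, 1, fun s => f (ρ s), fun s i j => congrFun₂ (hρ s) i j⟩
  rcases h1 with h1 | h1 <;> rcases h2 with h2 | h2
  · exact absurd (congrFun₂ (h2.trans h1.symm) 1 0) hne
  · refine ⟨1, fun s => ?_⟩
    fin_cases s
    exacts [h0.symm, h1.symm, h2.symm]
  · refine ⟨Equiv.swap 1 2, fun s => ?_⟩
    fin_cases s
    exacts [h0.symm, h2.symm, h1.symm]
  · exact absurd (congrFun₂ (h2.trans h1.symm) 1 0) hne
end

section
/- Up to isotopism, there is exactly one triple of mutually orthogonal 5 × 5 Latin squares; that is, triples of mutually orthogonal 5 × 5 Latin squares exist and any two such triples are isotopic. -/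
theorem Isotopic.trans {k n : ℕ} {M M' M'' : Fin 3 → Fin k → Fin n → Fin n}
    (h : Isotopic M M') (h' : Isotopic M' M'') : Isotopic M M'' := by
  obtain ⟨ρ, σr, σc, f, h⟩ := h
  obtain ⟨ρ', σr', σc', f', h'⟩ := h'
  exact ⟨ρ'.trans ρ, σr'.trans σr, σc'.trans σc, fun s => (f (ρ' s)).trans (f' s),
    fun s i j => by simp [h, h']⟩

theorem Orthogonal.eq_and_eq {k n : ℕ} {A B : Fin k → Fin n → Fin n} (h : Orthogonal A B)
    {i i' : Fin k} {j j' : Fin n} (hA : A i j = A i' j') (hB : B i j = B i' j') :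
    i = i' ∧ j = j' :=
  Prod.mk.inj (@h (i, j) (i', j') (Prod.ext hA hB))

theorem IsMOLRTriple.of_isotopic {k n : ℕ} {M M' : Fin 3 → Fin k → Fin n → Fin n}
    (hM : IsMOLRTriple M) (h : Isotopic M M') : IsMOLRTriple M' := by
  obtain ⟨ρ, σr, σc, f, h⟩ := h
  refine ⟨fun s => ⟨fun i a b hab => ?_, fun j a b hab => ?_⟩, fun s t hst => ?_⟩
  · simp only [h, EmbeddingLike.apply_eq_iff_eq] at hab
    exact σc.injective ((hM.1 (ρ s)).1 (σr i) hab)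
  · simp only [h, EmbeddingLike.apply_eq_iff_eq] at hab
    exact σr.injective ((hM.1 (ρ s)).2 (σc j) hab)
  · rintro ⟨i, j⟩ ⟨i', j'⟩ hab
    simp only [h, Prod.mk.injEq, EmbeddingLike.apply_eq_iff_eq] at hab
    have key := (hM.2 (ρ s) (ρ t) (ρ.injective.ne hst)).eq_and_eq hab.1 hab.2
    exact Prod.ext (σr.injective key.1) (σc.injective key.2)

/-- A transversal of a Latin square of order five meets every `2 × 2` Latin subsquare. -/
theorem exists_mem_intercalate {L N : Fin 5 → Fin 5 → Fin 5} (hL : IsLatinRectangle L)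
    (hN : IsLatinRectangle N) (hLN : Orthogonal L N) {r r' c c' : Fin 5} (hr : r ≠ r')
    (hc : c ≠ c') (h : L r c = L r' c') (h' : L r c' = L r' c) (x : Fin 5) :
    N r c = x ∨ N r c' = x ∨ N r' c = x ∨ N r' c' = x := by
  by_contra! hx
  obtain ⟨h₁, h₂, h₃, h₄⟩ := hx
  obtain ⟨t, ht⟩ := (Finite.injective_iff_surjective.1 (hN.1 r)) x
  obtain ⟨t', ht'⟩ := (Finite.injective_iff_surjective.1 (hN.1 r')) x
  obtain ⟨u, hu⟩ := (Finite.injective_iff_surjective.1 (hN.2 c)) x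
  obtain ⟨u', hu'⟩ := (Finite.injective_iff_surjective.1 (hN.2 c')) x
  simp only at hu hu'
  have htc : t ≠ c := by rintro rfl; exact h₁ ht
  have htc' : t ≠ c' := by rintro rfl; exact h₂ ht
  have htc₂ : t' ≠ c := by rintro rfl; exact h₃ ht'
  have htc₂' : t' ≠ c' := by rintro rfl; exact h₄ ht'
  have hur : u ≠ r := by rintro rfl; exact h₁ hu
  have hur' : u ≠ r' := by rintro rfl; exact h₃ hu
  have hur₂ : u' ≠ r := by rintro rfl; exact h₂ hu'
  have hur₂' : u' ≠ r' := by rintro rfl; exact h₄ hu'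
  have inj : ∀ {i j i' j'}, N i j = x → N i' j' = x → L i j = L i' j' → i = i' ∧ j = j' :=
    fun hi hi' hl => hLN.eq_and_eq hl (hi.trans hi'.symm)
  have hcard : ({L r c, L r c', L r t, L r' t', L u c, L u' c'} : Finset (Fin 5)).card = 6 := by
    have e₁ : ∀ {i j j'}, L i j = L i j' → j = j' := fun {i} _ _ e => hL.1 i e
    have e₂ : ∀ {i i' j}, L i j = L i' j → i = i' := fun {_ _ j} e => hL.2 j e
    have d₁ : L r c ∉ ({L r c', L r t, L r' t', L u c, L u' c'} : Finset (Fin 5)) := by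
      simp only [Finset.mem_insert, Finset.mem_singleton, not_or]
      exact ⟨fun e => hc (e₁ e), fun e => htc (e₁ e).symm,
        fun e => htc₂' (e₁ (h.symm.trans e)).symm, fun e => hur (e₂ e).symm,
        fun e => hur₂' (e₂ (h.symm.trans e)).symm⟩
    have d₂ : L r c' ∉ ({L r t, L r' t', L u c, L u' c'} : Finset (Fin 5)) := by
      simp only [Finset.mem_insert, Finset.mem_singleton, not_or]
      exact ⟨fun e => htc' (e₁ e).symm,
        fun e => htc₂ (e₁ (h'.symm.trans e)).symm, fun e => hur' (e₂ (h'.symm.trans e)).symm,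
        fun e => hur₂ (e₂ e).symm⟩
    have d₃ : L r t ∉ ({L r' t', L u c, L u' c'} : Finset (Fin 5)) := by
      simp only [Finset.mem_insert, Finset.mem_singleton, not_or]
      exact ⟨fun e => hr (inj ht ht' e).1, fun e => htc (inj ht hu e).2,
        fun e => htc' (inj ht hu' e).2⟩
    have d₄ : L r' t' ∉ ({L u c, L u' c'} : Finset (Fin 5)) := by
      simp only [Finset.mem_insert, Finset.mem_singleton, not_or]
      exact ⟨fun e => htc₂ (inj ht' hu e).2, fun e => htc₂' (inj ht' hu' e).2⟩
    have d₅ : L u c ∉ ({L u' c'} : Finset (Fin 5)) := by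
      simp only [Finset.mem_singleton]
      exact fun e => hc (inj hu hu' e).2
    rw [Finset.card_insert_of_notMem d₁, Finset.card_insert_of_notMem d₂,
      Finset.card_insert_of_notMem d₃, Finset.card_insert_of_notMem d₄,
      Finset.card_insert_of_notMem d₅, Finset.card_singleton]
  have := hcard ▸ Finset.card_le_univ
    ({L r c, L r c', L r t, L r' t', L u c, L u' c'} : Finset (Fin 5))
  simp at this

/-- A Latin square of order five with an orthogonal mate has no `2 × 2` Latin subsquare. -/
theorem not_intercalate {L N : Fin 5 → Fin 5 → Fin 5} (hL : IsLatinRectangle L)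
    (hN : IsLatinRectangle N) (hLN : Orthogonal L N) {r r' c c' : Fin 5} (hr : r ≠ r')
    (hc : c ≠ c') (h : L r c = L r' c') : L r c' ≠ L r' c := by
  intro h'
  have hsub : (Finset.univ : Finset (Fin 5)) ⊆ {N r c, N r c', N r' c, N r' c'} := by
    intro x _
    simpa [eq_comm] using exists_mem_intercalate hL hN hLN hr hc h h' x
  have h5 := Finset.card_le_card hsub
  have h4 := Finset.card_le_four (a := N r c) (b := N r c') (c := N r' c) (d := N r' c')
  simp only [Finset.card_univ, Fintype.card_fin] at h5
  omega

theorem eq_vec_five {α : Type*} (q : Fin 5 → α) : q = ![q 0, q 1, q 2, q 3, q 4] := by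
  ext i; fin_cases i <;> rfl

theorem orbit_injective_of_no_short_cycle (q : Fin 5 → Fin 5) (hq : Function.Injective q)
    (h₁ : ∀ j, q j ≠ j) (h₂ : ∀ j, q (q j) ≠ j) :
    (Function.Injective fun j : Fin 5 => q^[j] 0) ∧ q^[5] 0 = 0 := by
  have key : ∀ a b c d e : Fin 5, Function.Injective ![a, b, c, d, e] →
      (∀ j, ![a, b, c, d, e] j ≠ j) →
      (∀ j, ![a, b, c, d, e] (![a, b, c, d, e] j) ≠ j) →
      (Function.Injective fun j : Fin 5 => (![a, b, c, d, e])^[j] 0) ∧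
        (![a, b, c, d, e])^[5] 0 = 0 := by
    decide +kernel
  rw [eq_vec_five q] at hq h₁ h₂ ⊢
  exact key _ _ _ _ _ hq h₁ h₂

/-- The constraints on a row of a Latin square of order five that has rows `j` and `j + 1` and in
which neither of these forms a `2 × 2` Latin subsquare with the given row. -/
def IsAdmissibleRow (p : Fin 5 → Fin 5) : Prop :=
  (∀ j, p j ≠ j) ∧ (∀ j, p j ≠ j + 1) ∧ Function.Injective p ∧ (∀ j, p (p j) ≠ j) ∧
    ∀ j, p (p j - 1) ≠ j + 1

instance : DecidablePred IsAdmissibleRow := fun p => by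
  unfold IsAdmissibleRow
  infer_instance

theorem isAdmissibleRow_of_no_intercalate {L : Fin 5 → Fin 5 → Fin 5} (hL : IsLatinRectangle L)
    (hint : ∀ r r' c c', r ≠ r' → c ≠ c' → L r c = L r' c' → L r c' ≠ L r' c)
    (h₀ : ∀ j, L 0 j = j) (h₁ : ∀ j, L 1 j = j + 1) {i : Fin 5} (hi₀ : i ≠ 0) (hi₁ : i ≠ 1) :
    IsAdmissibleRow (L i) := by
  have hne₀ : ∀ j, L i j ≠ j := fun j e => hi₀ (hL.2 j (e.trans (h₀ j).symm))
  have hne₁ : ∀ j, L i j ≠ j + 1 := fun j e => hi₁ (hL.2 j (e.trans (h₁ j).symm))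
  refine ⟨hne₀, hne₁, hL.1 i, fun j e => ?_, fun j e => ?_⟩
  · exact hint 0 i (L i j) j hi₀.symm (hne₀ j) (h₀ _) (by rw [h₀, e])
  · exact hint 1 i (L i j - 1) j hi₁.symm (fun e => hne₁ j (sub_eq_iff_eq_add.1 e))
      (by rw [h₁, sub_add_cancel]) (by rw [h₁, e])

theorem admissibleRows_eq_add (a b c d : Fin 5) : IsAdmissibleRow ![2, a, b, c, d] →
    ∀ a' b' c' d', IsAdmissibleRow ![3, a', b', c', d'] →
    (∀ j, ![2, a, b, c, d] j ≠ ![3, a', b', c', d'] j) →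
    ∀ a'' b'' c'' d'', IsAdmissibleRow ![4, a'', b'', c'', d''] →
    (∀ j, ![2, a, b, c, d] j ≠ ![4, a'', b'', c'', d''] j) →
    (∀ j, ![3, a', b', c', d'] j ≠ ![4, a'', b'', c'', d''] j) →
    ∀ j, ![2, a, b, c, d] j = 2 + j ∧ ![3, a', b', c', d'] j = 3 + j ∧
      ![4, a'', b'', c'', d''] j = 4 + j := by
  revert a b c d
  decide +kernel

theorem eq_add_of_no_intercalate {L : Fin 5 → Fin 5 → Fin 5} (hL : IsLatinRectangle L)
    (hint : ∀ r r' c c', r ≠ r' → c ≠ c' → L r c = L r' c' → L r c' ≠ L r' c)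
    (h₀ : ∀ j, L 0 j = j) (h₁ : ∀ j, L 1 j = j + 1) (hcol : ∀ i, L i 0 = i) (i j : Fin 5) :
    L i j = i + j := by
  have hv : ∀ i, ![i, L i 1, L i 2, L i 3, L i 4] = L i := fun i => by
    simpa [hcol] using (eq_vec_five (L i)).symm
  have hadm : ∀ i, i ≠ 0 → i ≠ 1 → IsAdmissibleRow (L i) := fun i =>
    isAdmissibleRow_of_no_intercalate hL hint h₀ h₁
  have hdisj : ∀ i i', i ≠ i' → ∀ j, L i j ≠ L i' j := fun i i' h j e => h (hL.2 j e)
  have h := admissibleRows_eq_add (L 2 1) (L 2 2) (L 2 3) (L 2 4)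
  rw [hv] at h
  replace h := h (hadm 2 (by decide) (by decide)) (L 3 1) (L 3 2) (L 3 3) (L 3 4)
  rw [hv] at h
  replace h := h (hadm 3 (by decide) (by decide)) (hdisj 2 3 (by decide))
    (L 4 1) (L 4 2) (L 4 3) (L 4 4)
  rw [hv] at h
  replace h := h (hadm 4 (by decide) (by decide)) (hdisj 2 4 (by decide))
    (hdisj 3 4 (by decide)) j
  fin_cases i
  · simp [h₀]
  · simp [h₁, add_comm]
  · exact h.1
  · exact h.2.1
  · exact h.2.2

theorem transversal_add_linear (t : Fin 5 → Fin 5) (ht : Function.Injective t)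
    (ht' : Function.Injective fun i => i + t i) :
    ∃ a : Fin 5, (a = 2 ∨ a = 3 ∨ a = 4) ∧ ∀ i, t i = t 0 - a * i := by
  have key : ∀ a b c d e : Fin 5, Function.Injective ![a, b, c, d, e] →
      (Function.Injective fun i => i + ![a, b, c, d, e] i) →
      ∃ k : Fin 5, (k = 2 ∨ k = 3 ∨ k = 4) ∧
        ∀ i, ![a, b, c, d, e] i = ![a, b, c, d, e] 0 - k * i := by
    decide +kernel
  have h := key (t 0) (t 1) (t 2) (t 3) (t 4)
  rw [← eq_vec_five t] at h
  exact h ht ht'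

theorem mate_add_linear {N : Fin 5 → Fin 5 → Fin 5} (hN : IsLatinRectangle N)
    (hLN : Orthogonal (fun i j : Fin 5 => i + j) N) (h₀ : ∀ j, N 0 j = j) :
    ∃ a : Fin 5, (a = 2 ∨ a = 3 ∨ a = 4) ∧ ∀ i j, N i j = a * i + j := by
  have hs : ∀ x, ∃ a : Fin 5, (a = 2 ∨ a = 3 ∨ a = 4) ∧ ∀ i, N i (x - a * i) = x := by
    intro x
    choose t ht using fun i => (Finite.injective_iff_surjective.1 (hN.1 i)) x
    have h0 : t 0 = x := (h₀ (t 0)).symm.trans (ht 0)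
    obtain ⟨a, ha, hta⟩ := transversal_add_linear t
      (fun i i' e => hN.2 (t i) ((ht i).trans (by simp only [e, ht])))
      (fun i i' e => (hLN.eq_and_eq e ((ht i).trans (ht i').symm)).1)
    exact ⟨a, ha, fun i => by rw [← h0, ← hta, ht, h0]⟩
  choose a ha hNa using hs
  have hmeet : ∀ x y a b : Fin 5, a ≠ b → ∃ i, x - a * i = y - b * i := by decide +kernel
  have hconst : ∀ x y, a x = a y := by
    intro x y
    by_contra hne
    obtain ⟨i, hi⟩ := hmeet x y _ _ hne
    have hxy : x = y := by rw [← hNa x i, hi, hNa]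
    exact hne (hxy ▸ rfl)
  refine ⟨a 0, ha 0, fun i j => ?_⟩
  have h := hNa (a 0 * i + j) i
  rw [hconst (a 0 * i + j) 0] at h
  simpa using h

/-- The triple of squares `(s + 1) * i + j` over the integers modulo five. -/
def cyclicTriple (s : Fin 3) (i j : Fin 5) : Fin 5 := ![1, 2, 3] s * i + j

theorem isMOLRTriple_cyclicTriple : IsMOLRTriple cyclicTriple := by
  unfold IsMOLRTriple IsLatinRectangle Orthogonal
  decide +kernel

theorem isotopic_cyclicTriple_of_linear {a b : Fin 5} (ha : a = 2 ∨ a = 3 ∨ a = 4)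
    (hb : b = 2 ∨ b = 3 ∨ b = 4) (hab : a ≠ b) {M : Fin 3 → Fin 5 → Fin 5 → Fin 5}
    (hM : ∀ s i j, M s i j = ![1, a, b] s * i + j) : Isotopic M cyclicTriple := by
  have key : ∀ a b : Fin 5, (a = 2 ∨ a = 3 ∨ a = 4) → (b = 2 ∨ b = 3 ∨ b = 4) → a ≠ b →
      ∃ ρ : Equiv.Perm (Fin 3), ∃ k l : Fin 5, k * l = 1 ∧
        ∀ s, ![1, a, b] (ρ s) * k = ![1, 2, 3] s := by
    decide +kernel
  obtain ⟨ρ, k, l, hkl, h⟩ := key a b ha hb hab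
  refine ⟨ρ, ⟨fun i => k * i, fun i => l * i, fun i => ?_, fun i => ?_⟩, Equiv.refl _,
    fun _ => Equiv.refl _, fun s i j => ?_⟩
  · simp only [← mul_assoc, mul_comm l k, hkl, one_mul]
  · simp only [← mul_assoc, hkl, one_mul]
  · simp [cyclicTriple, hM, ← h, mul_assoc]

theorem exists_isotopic_first_row {M : Fin 3 → Fin 5 → Fin 5 → Fin 5} (hM : IsMOLRTriple M) :
    ∃ M', Isotopic M M' ∧ ∀ s j, M' s 0 j = j := by
  refine ⟨_, ⟨1, 1, 1, fun s => (Equiv.ofBijective (M s 0)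
    (Finite.injective_iff_bijective.1 ((hM.1 s).1 0))).symm, fun s i j => rfl⟩, fun s j => ?_⟩
  exact Equiv.ofBijective_symm_apply_apply (M s 0) _ j

theorem exists_isotopic_second_row {M : Fin 3 → Fin 5 → Fin 5 → Fin 5} (hM : IsMOLRTriple M)
    (h₀ : ∀ s j, M s 0 j = j) :
    ∃ M', Isotopic M M' ∧ (∀ s j, M' s 0 j = j) ∧ ∀ j, M' 0 1 j = j + 1 := by
  have hfix : ∀ j, M 0 1 j ≠ j := fun j e =>
    one_ne_zero ((hM.1 0).2 j (e.trans (h₀ 0 j).symm))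
  obtain ⟨hinj, h5⟩ := orbit_injective_of_no_short_cycle (M 0 1) ((hM.1 0).1 1) hfix
    (fun j e => not_intercalate (hM.1 0) (hM.1 1) (hM.2 0 1 (by decide))
      (zero_ne_one (α := Fin 5)) (hfix j) (h₀ 0 _) (by rw [h₀, e]))
  set σ := Equiv.ofBijective _ (Finite.injective_iff_bijective.1 hinj) with hσ
  refine ⟨_, ⟨1, 1, σ, fun _ => σ.symm, fun s i j => rfl⟩, fun s j => by simp [h₀], fun j => ?_⟩
  rw [Equiv.symm_apply_eq]
  simp only [hσ, Equiv.ofBijective_apply, Equiv.Perm.coe_one, id_eq,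
    ← Function.iterate_succ_apply' (M 0 1)]
  fin_cases j
  · rfl
  · rfl
  · rfl
  · rfl
  · exact h5

theorem exists_isotopic_first_column {M : Fin 3 → Fin 5 → Fin 5 → Fin 5} (hM : IsMOLRTriple M)
    (h₀ : ∀ s j, M s 0 j = j) (h₁ : ∀ j, M 0 1 j = j + 1) :
    ∃ M', Isotopic M M' ∧ (∀ s j, M' s 0 j = j) ∧ (∀ j, M' 0 1 j = j + 1) ∧
      ∀ i, M' 0 i 0 = i := by
  set τ := Equiv.ofBijective _ (Finite.injective_iff_bijective.1 ((hM.1 0).2 0)) with hτ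
  have hτ0 : τ.symm 0 = 0 := by rw [Equiv.symm_apply_eq]; simp [hτ, h₀]
  have hτ1 : τ.symm 1 = 1 := by rw [Equiv.symm_apply_eq]; simp [hτ, h₁]
  refine ⟨fun s i j => M s (τ.symm i) j, ⟨1, τ.symm, 1, fun _ => 1, fun s i j => rfl⟩,
    fun s j => by simp [hτ0, h₀], fun j => by simp [hτ1, h₁], fun i => ?_⟩
  exact τ.apply_symm_apply i

theorem IsMOLRTriple.isotopic_cyclicTriple {M : Fin 3 → Fin 5 → Fin 5 → Fin 5}
    (hM : IsMOLRTriple M) : Isotopic M cyclicTriple := by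
  obtain ⟨A, hMA, hA₀⟩ := exists_isotopic_first_row hM
  have hA := hM.of_isotopic hMA
  obtain ⟨B, hAB, hB₀, hB₁⟩ := exists_isotopic_second_row hA hA₀
  have hB := hA.of_isotopic hAB
  obtain ⟨C, hBC, hC₀, hC₁, hC₂⟩ := exists_isotopic_first_column hB hB₀ hB₁
  have hC := hB.of_isotopic hBC
  refine hMA.trans (hAB.trans (hBC.trans ?_))
  have hL : C 0 = fun i j => i + j := by
    ext1 i
    ext1 j
    exact eq_add_of_no_intercalate (hC.1 0)
      (fun _ _ _ _ hr hc h => not_intercalate (hC.1 0) (hC.1 1) (hC.2 0 1 (by decide)) hr hc h)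
      (hC₀ 0) hC₁ hC₂ i j
  obtain ⟨a, ha, hCa⟩ := mate_add_linear (hC.1 1) (hL ▸ hC.2 0 1 (by decide)) (hC₀ 1)
  obtain ⟨b, hb, hCb⟩ := mate_add_linear (hC.1 2) (hL ▸ hC.2 0 2 (by decide)) (hC₀ 2)
  refine isotopic_cyclicTriple_of_linear ha hb ?_ (fun s i j => ?_)
  · rintro rfl
    have h := (hC.2 1 2 (by decide)).eq_and_eq (i := 1) (j := 0) (i' := 0) (j' := a)
      (by simp [hCa]) (by simp [hCb])
    exact one_ne_zero h.1
  · fin_cases s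
    · simp [hL]
    · simp [hCa]
    · simp [hCb]

theorem stmt_12 :
    ∃ M : Fin 3 → Fin 5 → Fin 5 → Fin 5, IsMOLRTriple M ∧
      ∀ M' : Fin 3 → Fin 5 → Fin 5 → Fin 5, IsMOLRTriple M' → Isotopic M' M :=
  ⟨cyclicTriple, isMOLRTriple_cyclicTriple, fun _ h => h.isotopic_cyclicTriple⟩
end
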